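/- arXiv:math/0402193 — 2 statements merged into one kernel-verified Lean document; each statement's English description precedes it below -/
import Mathlib

section
/- Let 5 < n. There is a constant C, independent of λ, d ≤ λ and ω, such that for every u ∈ L²(ℝⁿ): ‖e^{±2πit|D_x|} B^ω_{λ,(λd)^{1/2}} u‖_{L²_t(L^∞_x)} ≤ C λ^{(n+1)/4} d^{(n−3)/4} ‖B^ω_{λ,(λd)^{1/2}} u‖_{L²} (local Strichartz estimate on radially directed blocks). -/
/- Common setup: space-time ℝ^{1+n}, Fourier multipliers, dyadic norms, function
   spaces of Tataru type, following Sterbenz, "Global Regularity for General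
   Non-Linear Wave Equations I". -/

open MeasureTheory Filter Real
open scoped ENNReal NNReal Topology RealInnerProductSpace

noncomputable section

namespace NLW

/-- Euclidean space ℝⁿ. -/
abbrev E (n : ℕ) := EuclideanSpace ℝ (Fin n)

variable {n : ℕ}

/-- `e^{ia}`. -/
def eC (a : ℝ) : ℂ := Complex.exp ((a : ℂ) * Complex.I)

/-- Space-time Fourier transform, convention `ũ(τ,ξ) = ∫ e^{-2πi(tτ+x·ξ)} u(t,x) dt dx`. -/
def stFT (u : ℝ → E n → ℂ) (τ : ℝ) (ξ : E n) : ℂ :=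
  ∫ t : ℝ, ∫ x : E n, eC (-(2 * π * (t * τ + ⟪x, ξ⟫))) * u t x

/-- Space-time Fourier multiplier with symbol `m(τ,ξ)`. -/
def stMult (m : ℝ → E n → ℂ) (u : ℝ → E n → ℂ) : ℝ → E n → ℂ := fun t x =>
  ∫ τ : ℝ, ∫ ξ : E n, eC (2 * π * (t * τ + ⟪x, ξ⟫)) * (m τ ξ * stFT u τ ξ)

/-- Spatial Fourier transform. -/
def spFT (f : E n → ℂ) (ξ : E n) : ℂ :=
  ∫ x : E n, eC (-(2 * π * ⟪x, ξ⟫)) * f x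

/-- Spatial Fourier multiplier with symbol `m(ξ)`. -/
def spMult (m : E n → ℂ) (f : E n → ℂ) : E n → ℂ := fun x =>
  ∫ ξ : E n, eC (2 * π * ⟪x, ξ⟫) * (m ξ * spFT f ξ)

/-- Spatial Fourier multiplier acting on space-time functions at each fixed time. -/
def spMultT (m : E n → ℂ) (u : ℝ → E n → ℂ) : ℝ → E n → ℂ := fun t => spMult m (u t)

/-- Mixed space-time Lebesgue norm `L^q_t(L^r_x)`. -/
def LqLr (q r : ℝ≥0∞) (u : ℝ → E n → ℂ) : ℝ≥0∞ :=
  eLpNorm (fun t => (eLpNorm (u t) r volume).toReal) q volume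

/-- Time derivative `∂_t`. -/
def Dt (u : ℝ → E n → ℂ) : ℝ → E n → ℂ := fun t x => deriv (fun s => u s x) t

/-- Spatial partial derivative `∂_{x_i}`. -/
def Dx (i : Fin n) (u : ℝ → E n → ℂ) : ℝ → E n → ℂ := fun t x =>
  fderiv ℝ (fun y => u t y) x (EuclideanSpace.single i 1)

/-- First-order space-time derivative, indexed by `Fin (n+1)`; index `0` is `∂_t`. -/
def PD (α : Fin (n + 1)) (u : ℝ → E n → ℂ) : ℝ → E n → ℂ :=
  if h : (α : ℕ) = 0 then Dt u
  else Dx (⟨(α : ℕ) - 1, by have := α.isLt; omega⟩ : Fin n) u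

/-- Spatial Laplacian. -/
def Lap (u : ℝ → E n → ℂ) : ℝ → E n → ℂ := fun t x =>
  ∑ i : Fin n, iteratedFDeriv ℝ 2 (fun y => u t y) x (fun _ => EuclideanSpace.single i 1)

/-- The d'Alembertian `□ = -∂_t² + Δ_x`. -/
def Box (u : ℝ → E n → ℂ) : ℝ → E n → ℂ := fun t x => -(Dt (Dt u) t x) + Lap u t x

/-- The Duhamel parametrix `□^{-1}F`, i.e. the solution of `□u = F` with
`u(0) = ∂_t u(0) = 0`, defined on the spatial Fourier side. -/
def BoxInv (F : ℝ → E n → ℂ) : ℝ → E n → ℂ := fun t x =>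
  ∫ ξ : E n, eC (2 * π * ⟪x, ξ⟫) *
    (-(∫ s in (0:ℝ)..t,
        ((Real.sin (2 * π * ‖ξ‖ * (t - s)) / (2 * π * ‖ξ‖) : ℝ) : ℂ) * spFT (F s) ξ))

/-- `W(f,g)`: the solution of the homogeneous wave equation with data `(f,g)`. -/
def FreeWave (f g : E n → ℂ) : ℝ → E n → ℂ := fun t x =>
  ∫ ξ : E n, eC (2 * π * ⟪x, ξ⟫) *
    (((Real.cos (2 * π * ‖ξ‖ * t) : ℝ) : ℂ) * spFT f ξ
      + ((Real.sin (2 * π * ‖ξ‖ * t) / (2 * π * ‖ξ‖) : ℝ) : ℂ) * spFT g ξ)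

/-- Half-wave propagator `e^{σ·2πit|D_x|}` (`σ = ±1`). -/
def halfWave (σ : ℝ) (f : E n → ℂ) : ℝ → E n → ℂ := fun t =>
  spMult (fun ξ => eC (σ * 2 * π * t * ‖ξ‖)) f

/-- `Ξ^{-1}`: division by the symbol of `□`, i.e. the space-time Fourier
multiplier with symbol `(4π²(τ² - |ξ|²))⁻¹`. -/
def XiInv (u : ℝ → E n → ℂ) : ℝ → E n → ℂ :=
  stMult (fun τ ξ => (((4 * π ^ 2 * (τ ^ 2 - ‖ξ‖ ^ 2) : ℝ) : ℂ))⁻¹) u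

/-- A smooth bump function equal to `1` on `[-1,1]` and supported in `[-2,2]`. -/
structure BumpFn where
  φ : ℝ → ℝ
  smooth : ContDiff ℝ (⊤ : ℕ∞) φ
  one_on : ∀ s : ℝ, |s| ≤ 1 → φ s = 1
  supp_sub : ∀ s : ℝ, 2 ≤ |s| → φ s = 0

/-- Space-time frequency magnitude `|(τ,ξ)|`. -/
def stnorm (τ : ℝ) (ξ : E n) : ℝ := Real.sqrt (τ ^ 2 + ‖ξ‖ ^ 2)

/-- Symbol `s_λ(τ,ξ) = φ_{2λ}(|(τ,ξ)|) - φ_{λ/2}(|(τ,ξ)|)`. -/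
def sSym (B : BumpFn) (lam : ℝ) (τ : ℝ) (ξ : E n) : ℂ :=
  ((B.φ (stnorm τ ξ / (2 * lam)) - B.φ (stnorm τ ξ / (lam / 2)) : ℝ) : ℂ)

/-- Symbol `c_d(τ,ξ) = φ_{2d}(||τ|-|ξ||) - φ_{d/2}(||τ|-|ξ||)`. -/
def cSym (B : BumpFn) (d : ℝ) (τ : ℝ) (ξ : E n) : ℂ :=
  ((B.φ (|(|τ| - ‖ξ‖)| / (2 * d)) - B.φ (|(|τ| - ‖ξ‖)| / (d / 2)) : ℝ) : ℂ)

/-- Smooth cutoff to the region `||τ|-|ξ|| ≲ d` (an `O(d)` neighborhood of the cone):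
symbol of `∑_{δ ≤ d} C_δ`. -/
def cLE (B : BumpFn) (d : ℝ) (τ : ℝ) (ξ : E n) : ℂ :=
  ((B.φ (|(|τ| - ‖ξ‖)| / (2 * d)) : ℝ) : ℂ)

/-- Smooth cutoff to the region `||τ|-|ξ|| < d`: symbol of `∑_{δ < d} C_δ`. -/
def cLT (B : BumpFn) (d : ℝ) (τ : ℝ) (ξ : E n) : ℂ :=
  ((B.φ (2 * |(|τ| - ‖ξ‖)| / d) : ℝ) : ℂ)

/-- Spatial Littlewood-Paley symbol `p_λ(ξ) = φ_{2λ}(|ξ|) - φ_{λ/2}(|ξ|)`. -/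
def pSym (B : BumpFn) (lam : ℝ) (ξ : E n) : ℂ :=
  ((B.φ (‖ξ‖ / (2 * lam)) - B.φ (‖ξ‖ / (lam / 2)) : ℝ) : ℂ)

/-- `S_λ`: space-time Littlewood-Paley projection. -/
def S (B : BumpFn) (lam : ℝ) : (ℝ → E n → ℂ) → ℝ → E n → ℂ := stMult (sSym B lam)

/-- `S_{λ,d} = S_λ C_d`. -/
def Sd (B : BumpFn) (lam d : ℝ) : (ℝ → E n → ℂ) → ℝ → E n → ℂ :=
  stMult (fun τ ξ => sSym B lam τ ξ * cSym B d τ ξ)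

/-- `S_{λ,•≤d}`: cutoff to an `O(d)` neighborhood of the light cone. -/
def SLE (B : BumpFn) (lam d : ℝ) : (ℝ → E n → ℂ) → ℝ → E n → ℂ :=
  stMult (fun τ ξ => sSym B lam τ ξ * cLE B d τ ξ)

/-- `S_{λ,•<d}`. -/
def SLT (B : BumpFn) (lam d : ℝ) : (ℝ → E n → ℂ) → ℝ → E n → ℂ :=
  stMult (fun τ ξ => sSym B lam τ ξ * cLT B d τ ξ)

/-- `S_{λ,d≤•} = S_λ - S_{λ,•<d}`. -/
def SGE (B : BumpFn) (lam d : ℝ) (u : ℝ → E n → ℂ) : ℝ → E n → ℂ := fun t x =>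
  S B lam u t x - SLT B lam d u t x

/-- Spatial Littlewood-Paley projection `P_λ`. -/
def P (B : BumpFn) (lam : ℝ) : (E n → ℂ) → E n → ℂ := spMult (pSym B lam)

/-- `P_λ` acting on space-time functions. -/
def PT (B : BumpFn) (lam : ℝ) : (ℝ → E n → ℂ) → ℝ → E n → ℂ := spMultT (pSym B lam)

/-- A system, for each pair of scales `λ, δ` (with `δ ≲ λ`), of smooth partitions of
unity `{b^ω_{λ,δ}}_{ω}` of the spatial annulus `{|ξ| ∼ λ}` subordinate to a
bounded-overlap cover by radially directed blocks of size `λ×δ×⋯×δ` (blocks directed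
along the unit vector `dir λ δ ω`), with the natural derivative bounds `λ^{-N}` along
the block and `δ^{-N}` transversally. -/
structure AngularSystem (n : ℕ) where
  b : ℝ → ℝ → ℕ → E n → ℝ
  dir : ℝ → ℝ → ℕ → E n
  Cb : ℕ → ℝ
  Cov : ℕ
  dir_norm : ∀ lam del ω, 0 < del → del ≤ 3 * lam → ‖dir lam del ω‖ = 1
  smooth : ∀ lam del ω, ContDiff ℝ (⊤ : ℕ∞) (b lam del ω)
  supp_sub : ∀ lam del ω ξ, 0 < del → del ≤ 3 * lam → b lam del ω ξ ≠ 0 →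
    lam / 4 ≤ ‖ξ‖ ∧ ‖ξ‖ ≤ 8 * lam ∧
      ‖ξ - (⟪ξ, dir lam del ω⟫) • dir lam del ω‖ ≤ 8 * del
  deriv_par : ∀ lam del ω ξ (N : ℕ), 0 < del → del ≤ 3 * lam →
    ‖iteratedFDeriv ℝ N (b lam del ω) ξ (fun _ => dir lam del ω)‖ ≤ Cb N * lam ^ (-(N : ℝ))
  deriv_perp : ∀ lam del ω ξ (N : ℕ) (e : E n), 0 < del → del ≤ 3 * lam →
    ‖e‖ = 1 → (⟪e, dir lam del ω⟫) = 0 →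
    ‖iteratedFDeriv ℝ N (b lam del ω) ξ (fun _ => e)‖ ≤ Cb N * del ^ (-(N : ℝ))
  overlap : ∀ lam del ξ, 0 < del → del ≤ 3 * lam →
    {ω | b lam del ω ξ ≠ 0}.Finite ∧ Nat.card {ω | b lam del ω ξ ≠ 0} ≤ Cov
  partition : ∀ lam del ξ, 0 < del → del ≤ 3 * lam →
    lam / 2 ≤ ‖ξ‖ → ‖ξ‖ ≤ 4 * lam → ∑' ω, b lam del ω ξ = 1

/-- The block multiplier `B^ω_{λ,δ}` on spatial functions. -/
def BOmSp (A : AngularSystem n) (lam del : ℝ) (ω : ℕ) : (E n → ℂ) → E n → ℂ :=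
  spMult (fun ξ => ((A.b lam del ω ξ : ℝ) : ℂ))

/-- The block multiplier `B^ω_{λ,δ}` on space-time functions. -/
def BOm (A : AngularSystem n) (lam del : ℝ) (ω : ℕ) : (ℝ → E n → ℂ) → ℝ → E n → ℂ :=
  spMultT (fun ξ => ((A.b lam del ω ξ : ℝ) : ℂ))

/-- `S^ω_{λ,d} = B^ω_{λ,(λd)^{1/2}} S_{λ,d}`. -/
def SOm (B : BumpFn) (A : AngularSystem n) (lam d : ℝ) (ω : ℕ) :
    (ℝ → E n → ℂ) → ℝ → E n → ℂ := fun u =>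
  BOm A lam (Real.sqrt (lam * d)) ω (Sd B lam d u)

/-- `S^ω_{λ,•≤d} = B^ω_{λ,(λd)^{1/2}} S_{λ,•≤d}`. -/
def SOmLE (B : BumpFn) (A : AngularSystem n) (lam d : ℝ) (ω : ℕ) :
    (ℝ → E n → ℂ) → ℝ → E n → ℂ := fun u =>
  BOm A lam (Real.sqrt (lam * d)) ω (SLE B lam d u)

/-- The dyadic number `2^j`. -/
def dy (j : ℤ) : ℝ := (2 : ℝ) ^ j

/-- The `X^{1/2}_{λ,1}` norm: `∑_{d ∈ 2^ℤ} d^{1/2} ‖S_{λ,d}u‖_{L²(L²)}`. -/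
def Xnorm (B : BumpFn) (lam : ℝ) (u : ℝ → E n → ℂ) : ℝ≥0∞ :=
  ∑' j : ℤ, ENNReal.ofReal (dy j ^ ((1 : ℝ) / 2)) * LqLr 2 2 (Sd B lam (dy j) u)

/-- The `Y_λ` norm: `λ^{-1}‖□S_λu‖_{L¹(L²)}`. -/
def Ynorm (B : BumpFn) (lam : ℝ) (u : ℝ → E n → ℂ) : ℝ≥0∞ :=
  ENNReal.ofReal lam⁻¹ * LqLr 1 2 (Box (S B lam u))

/-- The outer-block `Z_λ` norm:
`λ^{(2-n)/2} ∑_d (∑_ω ‖S^ω_{λ,d}u‖²_{L¹(L^∞)})^{1/2}`. -/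
def Znorm (B : BumpFn) (A : AngularSystem n) (lam : ℝ) (u : ℝ → E n → ℂ) : ℝ≥0∞ :=
  ENNReal.ofReal (lam ^ ((2 - (n : ℝ)) / 2)) *
    ∑' j : ℤ, (∑' ω : ℕ, (LqLr 1 ⊤ (SOm B A lam (dy j) ω u)) ^ 2) ^ ((1 : ℝ) / 2)

/-- The `F_λ` norm: `(X^{1/2}_{λ,1} + Y_λ) ∩ S_λ(L^∞(L²))`. -/
def Fnorm (B : BumpFn) (lam : ℝ) (u : ℝ → E n → ℂ) : ℝ≥0∞ :=
  (⨅ v : ℝ → E n → ℂ, Xnorm B lam v + Ynorm B lam (fun t x => u t x - v t x)) + LqLr ⊤ 2 u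

/-- The `G_λ` norm: `F_λ ∩ Z_λ`. -/
def Gnorm (B : BumpFn) (A : AngularSystem n) (lam : ℝ) (u : ℝ → E n → ℂ) : ℝ≥0∞ :=
  Fnorm B lam u + Znorm B A lam u

/-- The `F^s` norm: `(∑_λ λ^{2s}‖u‖²_{F_λ})^{1/2}`. -/
def FSnorm (B : BumpFn) (s : ℝ) (u : ℝ → E n → ℂ) : ℝ≥0∞ :=
  (∑' k : ℤ, ENNReal.ofReal (dy k ^ (2 * s)) * (Fnorm B (dy k) u) ^ 2) ^ ((1 : ℝ) / 2)

/-- The `G^s` norm: `∑_λ λ^s ‖u‖_{G_λ}`. -/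
def GSnorm (B : BumpFn) (A : AngularSystem n) (s : ℝ) (u : ℝ → E n → ℂ) : ℝ≥0∞ :=
  ∑' k : ℤ, ENNReal.ofReal (dy k ^ s) * Gnorm B A (dy k) u

/-- The homogeneous Besov norm `‖f‖_{Ḃ^{s,1}} = ∑_{λ} λ^s ‖P_λ f‖_{L²}`. -/
def BesovNorm (B : BumpFn) (s : ℝ) (f : E n → ℂ) : ℝ≥0∞ :=
  ∑' k : ℤ, ENNReal.ofReal (dy k ^ s) * eLpNorm (P B (dy k) f) 2 volume

/-- The homogeneous Sobolev norm `‖f‖_{Ḣ^s} = (∑_{λ} λ^{2s} ‖P_λ f‖²_{L²})^{1/2}`. -/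
def SobNorm (B : BumpFn) (s : ℝ) (f : E n → ℂ) : ℝ≥0∞ :=
  (∑' k : ℤ, ENNReal.ofReal (dy k ^ (2 * s)) * (eLpNorm (P B (dy k) f) 2 volume) ^ 2) ^
    ((1 : ℝ) / 2)

lemma gam (m : ℕ) (hm : 1 ≤ m) : ∃ C : ℝ, 0 ≤ C ∧ ∀ p : ℂ, 0 < p.re →
    ‖∫ η in Set.Ioi (0:ℝ), ((η ^ ((m:ℝ)/2-1) : ℝ) : ℂ) * Complex.exp (-p * η)‖
      ≤ C * ‖p‖ ^ (-((m:ℝ)/2)) := by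
  have : Nonempty (Fin m) := ⟨⟨0, hm⟩⟩
  have : Nontrivial (EuclideanSpace ℝ (Fin m)) := inferInstance
  set V := EuclideanSpace ℝ (Fin m)
  set κ : ℝ := (m:ℝ) * (volume : Measure V).real (Metric.ball 0 1) with hκ
  have hκ0 : 0 < κ := by
    apply mul_pos (by exact_mod_cast hm)
    rw [Measure.real, ENNReal.toReal_pos_iff]
    exact ⟨Metric.measure_ball_pos _ _ one_pos, measure_ball_lt_top⟩
  refine ⟨2 / κ * π ^ ((m:ℝ)/2), by positivity, fun p hp => ?_⟩
  have hp0 : p ≠ 0 := by rintro rfl; simp at hp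
  have h1 := GaussianFourier.integral_cexp_neg_mul_sq_norm_add (V := V) hp 0 0
  have h2 := integral_fun_norm_addHaar (volume : Measure V)
    (fun r : ℝ => Complex.exp (-p * (r:ℂ)^2))
  have h3 := integral_comp_rpow_Ioi_of_pos (E := ℂ)
    (g := fun y : ℝ => y ^ (m - 1) • Complex.exp (-p * (y:ℂ)^2)) (p := 1/2) (by norm_num)
  simp only [zero_mul, add_zero] at h1
  rw [h1] at h2
  simp only [V, finrank_euclideanSpace, Fintype.card_fin] at h2
  rw [← h3] at h2
  have h4 : ∀ η ∈ Set.Ioi (0:ℝ), ((1/2 : ℝ) * η ^ ((1/2:ℝ) - 1)) •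
      ((η ^ (1/2:ℝ)) ^ (m - 1) • Complex.exp (-p * ((η ^ (1/2:ℝ) : ℝ):ℂ)^2))
      = (1/2 : ℂ) * (((η ^ ((m:ℝ)/2-1) : ℝ) : ℂ) * Complex.exp (-p * η)) := by
    intro η hη
    have hη : 0 < η := hη
    have e1 : (((η ^ (1/2:ℝ) : ℝ):ℂ)^2) = η := by
      rw [← Complex.ofReal_pow, ← Real.rpow_natCast, ← Real.rpow_mul hη.le]; norm_num
    rw [e1, smul_smul, Complex.real_smul, ← mul_assoc]
    congr 1
    rw [← Real.rpow_natCast, ← Real.rpow_mul hη.le, mul_assoc, ← Real.rpow_add hη,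
      Nat.cast_sub hm]
    push_cast
    congr 3
    ring_nf
  rw [setIntegral_congr_fun measurableSet_Ioi h4, integral_const_mul] at h2
  have h5 := congrArg norm h2
  rw [nsmul_eq_mul] at h5
  simp only [norm_mul, norm_smul, Complex.norm_exp] at h5
  have h6 : ‖((π:ℂ) / p) ^ (((m:ℕ):ℂ)/2)‖ = π ^ ((m:ℝ)/2) * ‖p‖ ^ (-((m:ℝ)/2)) := by
    rw [show ((m:ℂ)/2) = (((m:ℝ)/2 : ℝ) : ℂ) by push_cast; rfl, Complex.norm_cpow_real,
      norm_div, Real.div_rpow (norm_nonneg _) (norm_nonneg _), Real.rpow_neg (norm_nonneg _)]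
    simp [abs_of_pos Real.pi_pos]
    rfl
  rw [h6] at h5
  have h7 : ‖(m:ℂ)‖ = m := by simp
  have h8 : ‖(1/2:ℂ)‖ = 1/2 := by simp
  rw [h7, h8, Real.norm_of_nonneg measureReal_nonneg] at h5
  simp only [norm_zero, Complex.ofReal_zero] at h5
  norm_num at h5
  set J := ‖∫ η in Set.Ioi (0:ℝ), ((η ^ ((m:ℝ)/2-1) : ℝ) : ℂ) * Complex.exp (-p * η)‖
  have : J = 2 / κ * (κ * (1/2) * J) := by field_simp
  rw [this, mul_assoc (2/κ), h5]
  apply le_of_eq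
  simp only [J, hκ, V, neg_mul]
  ring

lemma chvar (R : ℝ) (hR : 0 < R) (P Q : ℂ) :
    ∫ a : ℝ, Complex.exp (-P * ((√(a^2+R) + a : ℝ):ℂ) - Q * ((√(a^2+R) - a : ℝ):ℂ))
        * ((1 / √(a^2+R) : ℝ) : ℂ)
      = ∫ η in Set.Ioi (0:ℝ), ((1/η : ℝ):ℂ) * Complex.exp (-P * η - Q * ((R / η : ℝ):ℂ)) := by
  set f : ℝ → ℝ := fun η => (η - R/η)/2 with hf
  have hsq : ∀ η : ℝ, 0 < η → √((f η)^2 + R) = (η + R/η)/2 := by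
    intro η hη
    rw [show (f η)^2 + R = ((η + R/η)/2)^2 by simp only [hf]; field_simp; ring]
    exact Real.sqrt_sq (by positivity)
  have hinj : Set.InjOn f (Set.Ioi 0) := by
    intro x hx y hy hxy
    have h1 := hsq x hx
    have h2 := hsq y hy
    rw [hxy, h2] at h1
    simp only [hf] at hxy
    linarith
  have himg : f '' (Set.Ioi 0) = Set.univ := by
    rw [Set.eq_univ_iff_forall]
    intro a
    have h0 : |a| < √(a^2+R) := by
      rw [← Real.sqrt_sq_eq_abs]; exact Real.sqrt_lt_sqrt (sq_nonneg _) (by linarith)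
    have h1 : 0 < √(a^2+R) + a := by linarith [neg_abs_le a]
    refine ⟨√(a^2+R) + a, h1, ?_⟩
    simp only [hf]
    have h2 : √(a^2+R)^2 = a^2+R := Real.sq_sqrt (by positivity)
    field_simp
    nlinarith
  have hder : ∀ x ∈ Set.Ioi (0:ℝ), HasDerivWithinAt f ((1 + R/x^2)/2) (Set.Ioi 0) x := by
    intro x hx
    have hx : 0 < x := hx
    have := (((hasDerivAt_id x).sub ((hasDerivAt_inv hx.ne').const_mul R)).div_const 2)
    refine (this.congr_deriv ?_).hasDerivWithinAt
    field_simp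
    ring
  have key := integral_image_eq_integral_abs_deriv_smul measurableSet_Ioi hder hinj
    (fun a : ℝ => Complex.exp (-P * ((√(a^2+R) + a : ℝ):ℂ) - Q * ((√(a^2+R) - a : ℝ):ℂ))
        * ((1 / √(a^2+R) : ℝ) : ℂ))
  rw [himg, setIntegral_univ] at key
  rw [key]
  refine setIntegral_congr_fun measurableSet_Ioi fun η hη => ?_
  have hη : 0 < η := hη
  simp only [hsq η hη]
  rw [Complex.real_smul, mul_comm (Complex.exp _), ← mul_assoc, ← Complex.ofReal_mul]
  congr 2
  · rw [abs_of_pos (by positivity)]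
    field_simp
  · simp only [hf]
    congr 3
    · ring
    · ring

lemma mul_cpow_pos (η : ℝ) (hη : 0 < η) (w : ℂ) (hw : w ≠ 0) (c : ℂ) :
    ((η:ℂ) * w) ^ c = (η:ℂ) ^ c * w ^ c := by
  have h : (η:ℂ) ≠ 0 := by exact_mod_cast hη.ne'
  rw [Complex.cpow_def_of_ne_zero (mul_ne_zero h hw), Complex.cpow_def_of_ne_zero h,
    Complex.cpow_def_of_ne_zero hw, Complex.log_ofReal_mul hη hw, ← Complex.exp_add,
    Complex.ofReal_log hη.le, add_mul]

lemma gauss_step {F : Type*} [NormedAddCommGroup F] [InnerProductSpace ℝ F]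
    [FiniteDimensional ℝ F] [MeasurableSpace F] [BorelSpace F] (P Q : ℂ)
    (hQ : 0 < Q.re) (z : F) (η : ℝ) (hη : 0 < η) :
    ∫ v : F, (((1/η : ℝ):ℂ) * Complex.exp (-P * η - Q * ((‖v‖^2 / η : ℝ):ℂ)))
        * Complex.exp (2 * π * Complex.I * (⟪z, v⟫ : ℝ))
      = ((π:ℂ) / Q) ^ ((((Module.finrank ℝ F : ℝ)/2 : ℝ)):ℂ) *
        (((η ^ ((Module.finrank ℝ F : ℝ)/2-1) : ℝ) : ℂ) *
          Complex.exp (-(P + π^2*‖z‖^2/Q) * η)) := by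
  have hQ0 : Q ≠ 0 := by rintro rfl; simp at hQ
  have hη0 : (η:ℂ) ≠ 0 := by exact_mod_cast hη.ne'
  have hb : 0 < (Q / η).re := by
    rw [Complex.div_ofReal_re]; positivity
  have h := GaussianFourier.integral_cexp_neg_mul_sq_norm_add (V := F) hb (2 * π * Complex.I) z
  have e1 : ∀ v : F, (((1/η : ℝ):ℂ) * Complex.exp (-P * η - Q * ((‖v‖^2 / η : ℝ):ℂ)))
        * Complex.exp (2 * π * Complex.I * (⟪z, v⟫ : ℝ)) =
        (((1/η : ℝ):ℂ) * Complex.exp (-P * η)) *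
        Complex.exp (-(Q/η) * ‖v‖^2 + 2 * π * Complex.I * (⟪z, v⟫ : ℝ)) := by
    intro v
    rw [mul_assoc ((1/η : ℝ):ℂ), mul_assoc ((1/η : ℝ):ℂ), ← Complex.exp_add, ← Complex.exp_add]
    congr 2
    push_cast
    ring
  simp_rw [e1]
  rw [integral_const_mul, h]
  rw [show (π:ℂ) / (Q/η) = (η:ℂ) * (π/Q) by field_simp, mul_cpow_pos η hη _ (by
    exact div_ne_zero (by exact_mod_cast Real.pi_ne_zero) hQ0)]
  have e2 : ((1/η : ℝ):ℂ) * (η:ℂ) ^ ((Module.finrank ℝ F : ℂ)/2)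
      = ((η ^ ((Module.finrank ℝ F : ℝ)/2-1) : ℝ) : ℂ) := by
    rw [Real.rpow_sub hη, Real.rpow_one]
    push_cast
    rw [Complex.ofReal_cpow hη.le]
    push_cast
    ring
  have e3 : Complex.exp (-(P + π^2*‖z‖^2/Q) * η) = Complex.exp (-P * η) *
      Complex.exp ((2 * π * Complex.I) ^ 2 * ‖z‖ ^ 2 / (4 * (Q / η))) := by
    rw [← Complex.exp_add]
    congr 1
    have : (2 * π * Complex.I : ℂ) ^ 2 = -(4 * π^2) := by
      rw [mul_pow, Complex.I_sq]; ring
    rw [this]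
    field_simp
    ring
  rw [← e2, e3]
  push_cast
  ring

lemma int_step {F : Type*} [NormedAddCommGroup F] [InnerProductSpace ℝ F]
    [FiniteDimensional ℝ F] [MeasurableSpace F] [BorelSpace F] (P Q : ℂ)
    (hP : 0 < P.re) (hQ : 0 < Q.re) (z : F) (hF : 1 ≤ Module.finrank ℝ F) :
    Integrable (fun p : F × ℝ => (((1/p.2 : ℝ):ℂ) * Complex.exp (-P * p.2
        - Q * ((‖p.1‖^2 / p.2 : ℝ):ℂ))) * Complex.exp (2 * π * Complex.I * (⟪z, p.1⟫ : ℝ)))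
      ((volume : Measure F).prod (volume.restrict (Set.Ioi (0:ℝ)))) := by
  have hmeas : Measurable (fun p : F × ℝ => (((1/p.2 : ℝ):ℂ) * Complex.exp (-P * p.2
        - Q * ((‖p.1‖^2 / p.2 : ℝ):ℂ))) * Complex.exp (2 * π * Complex.I * (⟪z, p.1⟫ : ℝ))) := by
    fun_prop
  rw [integrable_prod_iff' hmeas.aestronglyMeasurable]
  -- norm
  have hnorm : ∀ η : ℝ, 0 < η → ∀ v : F, ‖(((1/η : ℝ):ℂ) * Complex.exp (-P * η
        - Q * ((‖v‖^2 / η : ℝ):ℂ))) * Complex.exp (2 * π * Complex.I * (⟪z, v⟫ : ℝ))‖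
        = (1/η) * rexp (-P.re * η) * rexp (-(Q.re/η) * ‖v‖^2) := by
    intro η hη v
    rw [norm_mul, norm_mul, Complex.norm_exp, Complex.norm_exp, Complex.norm_real,
      Real.norm_of_nonneg (by positivity), mul_assoc (1/η), mul_assoc (1/η), ← Real.exp_add, ← Real.exp_add]
    congr 2
    have h0 : (2 * π * Complex.I * (⟪z, v⟫ : ℝ) : ℂ).re = 0 := by simp
    rw [h0]
    simp only [Complex.sub_re, Complex.re_mul_ofReal, Complex.neg_re]
    ring
  have hg : ∀ η : ℝ, 0 < η → Integrable (fun v : F => rexp (-(Q.re/η) * ‖v‖^2)) := by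
    intro η hη
    have := GaussianFourier.integrable_cexp_neg_mul_sq_norm_add (V := F)
      (b := ((Q.re/η : ℝ):ℂ)) (by rw [Complex.ofReal_re]; positivity) 0 0
    refine this.norm.congr (ae_of_all _ fun v => ?_)
    simp only [Complex.norm_exp]
    congr 1
    rw [zero_mul, add_zero, ← Complex.ofReal_neg, ← Complex.ofReal_pow, ← Complex.ofReal_mul,
      Complex.ofReal_re]
  constructor
  · refine (ae_restrict_iff' measurableSet_Ioi).2 (ae_of_all _ fun η hη => ?_)
    have hη : 0 < η := hη
    have h1 : AEStronglyMeasurable (fun v : F => (((1/η : ℝ):ℂ) * Complex.exp (-P * η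
        - Q * ((‖v‖^2 / η : ℝ):ℂ))) * Complex.exp (2 * π * Complex.I * (⟪z, v⟫ : ℝ))) volume :=
      (by fun_prop : Measurable _).aestronglyMeasurable
    refine (integrable_norm_iff h1).1 ?_
    simp_rw [hnorm η hη]
    exact (hg η hη).const_mul _
  · have : Set.EqOn (fun η : ℝ => (π/Q.re) ^ ((Module.finrank ℝ F : ℝ)/2) *
        (η ^ ((Module.finrank ℝ F : ℝ)/2 - 1) * rexp (-(P.re * η))))
        (fun η : ℝ => ∫ v : F, ‖(((1/η : ℝ):ℂ) * Complex.exp (-P * η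
        - Q * ((‖v‖^2 / η : ℝ):ℂ))) * Complex.exp (2 * π * Complex.I * (⟪z, v⟫ : ℝ))‖)
        (Set.Ioi 0) := by
      intro η hη
      have hη : 0 < η := hη
      simp only
      simp_rw [hnorm η hη]
      rw [integral_const_mul, GaussianFourier.integral_rexp_neg_mul_sq_norm (by positivity),
        show π / (Q.re/η) = (π/Q.re) * η by field_simp,
        Real.mul_rpow (by positivity) hη.le, Real.rpow_sub hη, Real.rpow_one, neg_mul]
      ring
    refine IntegrableOn.congr_fun ?_ this measurableSet_Ioi
    refine Integrable.const_mul ?_ _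
    have hm : (0:ℝ) < (Module.finrank ℝ F : ℝ)/2 := by
      have : (1:ℝ) ≤ Module.finrank ℝ F := by exact_mod_cast hF
      positivity
    have := integrableOn_rpow_mul_exp_neg_mul_rpow (s := (Module.finrank ℝ F : ℝ)/2 - 1) (p := 1)
      (b := P.re) (by linarith) (by norm_num) hP
    simp only [Real.rpow_one, neg_mul] at this
    exact this

lemma kern_F (m : ℕ) (hm : 1 ≤ m) : ∃ C : ℝ, 0 ≤ C ∧ ∀ {F : Type} [NormedAddCommGroup F]
    [InnerProductSpace ℝ F]
    [FiniteDimensional ℝ F] [MeasurableSpace F] [BorelSpace F] (P Q : ℂ),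
    0 < P.re → 0 < Q.re → ∀ z : F, Module.finrank ℝ F = m →
    ‖∫ v : F, ∫ a : ℝ, (Complex.exp (-P * ((√(a^2+‖v‖^2) + a : ℝ):ℂ)
        - Q * ((√(a^2+‖v‖^2) - a : ℝ):ℂ))
        * ((1 / √(a^2+‖v‖^2) : ℝ) : ℂ)) * Complex.exp (2 * π * Complex.I * (⟪z, v⟫ : ℝ))‖
    ≤ C * ‖P * Q + π^2 * ‖z‖^2‖ ^ (-((m:ℝ)/2)) := by
  obtain ⟨C, hC, h⟩ := gam m hm
  refine ⟨π ^ ((m:ℝ)/2) * C, by positivity, ?_⟩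
  intro F _ _ _ _ _ P Q hP hQ z hF
  have hQ0 : Q ≠ 0 := by rintro rfl; simp at hQ
  have : Nontrivial F := Module.nontrivial_of_finrank_pos (R := ℝ) (by omega)
  have h1 : ∀ᵐ v : F, ∫ a : ℝ, (Complex.exp (-P * ((√(a^2+‖v‖^2) + a : ℝ):ℂ)
        - Q * ((√(a^2+‖v‖^2) - a : ℝ):ℂ))
        * ((1 / √(a^2+‖v‖^2) : ℝ) : ℂ)) * Complex.exp (2 * π * Complex.I * (⟪z, v⟫ : ℝ))
      = ∫ η in Set.Ioi (0:ℝ), (((1/η : ℝ):ℂ) * Complex.exp (-P * η - Q * ((‖v‖^2 / η : ℝ):ℂ)))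
        * Complex.exp (2 * π * Complex.I * (⟪z, v⟫ : ℝ)) := by
    have : ∀ᵐ v : F, v ≠ 0 := by
      simp [ae_iff]
    filter_upwards [this] with v hv
    rw [integral_mul_const, integral_mul_const, chvar _ (by positivity)]
  rw [integral_congr_ae h1]
  rw [integral_integral_swap (f := fun (v : F) (η : ℝ) => (((1/η : ℝ):ℂ) *
      Complex.exp (-P * η - Q * ((‖v‖^2 / η : ℝ):ℂ)))
        * Complex.exp (2 * π * Complex.I * (⟪z, v⟫ : ℝ)))
      (int_step P Q hP hQ z (by omega))]
  rw [setIntegral_congr_fun measurableSet_Ioi (fun η hη => gauss_step P Q hQ z η hη)]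
  rw [integral_const_mul, norm_mul, Complex.norm_cpow_real, hF]
  set W := P + π^2*‖z‖^2/Q with hW
  have hWre : 0 < W.re := by
    have : (π^2*‖z‖^2/Q : ℂ).re = π^2*‖z‖^2 * (Q.re / Complex.normSq Q) := by
      rw [div_eq_mul_inv, show (π^2*‖z‖^2 : ℂ) = ((π^2*‖z‖^2 : ℝ):ℂ) by push_cast; rfl,
        Complex.re_ofReal_mul, Complex.inv_re]
    rw [hW, Complex.add_re, this]
    have := Complex.normSq_pos.2 hQ0
    positivity
  have h2 := h W hWre
  have h3 : P * Q + π^2 * ‖z‖^2 = W * Q := by rw [hW]; field_simp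
  have hQn : 0 < ‖Q‖ := norm_pos_iff.2 hQ0
  rw [h3, norm_mul, Real.mul_rpow (norm_nonneg _) (norm_nonneg _), norm_div,
    Real.div_rpow (norm_nonneg _) (norm_nonneg _), Complex.norm_real,
    Real.norm_of_nonneg pi_pos.le]
  calc _ ≤ π ^ ((m:ℝ)/2) / ‖Q‖ ^ ((m:ℝ)/2) * (C * ‖W‖ ^ (-((m:ℝ)/2))) := by gcongr
    _ = _ := by rw [Real.rpow_neg hQn.le]; ring

lemma eC_norm (a : ℝ) : ‖eC a‖ = 1 := by
  unfold eC; exact Complex.norm_exp_ofReal_mul_I a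

lemma eC_add (a b : ℝ) : eC (a + b) = eC a * eC b := by
  unfold eC; rw [← Complex.exp_add]; congr 1; push_cast; ring

lemma eC_conj (a : ℝ) : (starRingEnd ℂ) (eC a) = eC (-a) := by
  unfold eC; rw [← Complex.exp_conj]; congr 1; simp

lemma eC_cont : Continuous eC := by unfold eC; fun_prop

/-- The auxiliary weight adapted to the direction `e`. -/
def wt (e : E n) (lam d : ℝ) (ξ : E n) : ℝ :=
  rexp (-((‖ξ‖ + ⟪ξ, e⟫) / lam) - π * (‖ξ‖ - ⟪ξ, e⟫) / d) * (1 / ‖ξ‖)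

lemma wt_nonneg (e : E n) (lam d : ℝ) (ξ : E n) : 0 ≤ wt e lam d ξ := by
  unfold wt; positivity

lemma wt_meas (e : E n) (lam d : ℝ) : Measurable (wt e lam d) := by
  unfold wt; fun_prop

lemma wt_int (hn : 2 ≤ n) (e : E n) (he : ‖e‖ = 1) (lam d : ℝ) (hd : 0 < d) (hdl : d ≤ lam) :
    Integrable (wt e lam d) := by
  have hl : 0 < lam := hd.trans_le hdl
  have : Nonempty (Fin n) := ⟨⟨0, by omega⟩⟩
  have hI : Integrable (fun ξ : E n => rexp (-(2/lam) * ‖ξ‖) * (1/‖ξ‖)) := by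
    rw [integrable_fun_norm_addHaar (volume : Measure (E n))
      (f := fun r : ℝ => rexp (-(2/lam) * r) * (1/r))]
    simp only [finrank_euclideanSpace, Fintype.card_fin]
    have h := integrableOn_rpow_mul_exp_neg_mul_rpow (s := (n:ℝ) - 2) (p := 1)
      (b := 2/lam) (by have : (2:ℝ) ≤ n := by exact_mod_cast hn
                       linarith) (by norm_num) (by positivity)
    refine h.congr_fun (fun r hr => ?_) measurableSet_Ioi
    have hr : 0 < r := hr
    simp only [Real.rpow_one, smul_eq_mul]
    rw [show (n:ℝ) - 2 = ((n - 2 : ℕ) : ℝ) by rw [Nat.cast_sub hn]; norm_num, Real.rpow_natCast,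
      show n - 1 = (n-2) + 1 by omega, pow_succ]
    field_simp
  refine hI.mono' (wt_meas e lam d).aestronglyMeasurable (ae_of_all _ fun ξ => ?_)
  rw [Real.norm_of_nonneg (wt_nonneg _ _ _ _)]
  unfold wt
  gcongr
  have h1 : |⟪ξ, e⟫| ≤ ‖ξ‖ := by simpa [he] using abs_real_inner_le_norm ξ e
  have h2 : (‖ξ‖ - ⟪ξ, e⟫) / lam ≤ π * (‖ξ‖ - ⟪ξ, e⟫) / d := by
    have h3 : 0 ≤ ‖ξ‖ - ⟪ξ, e⟫ := by linarith [le_abs_self ⟪ξ, e⟫]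
    calc (‖ξ‖ - ⟪ξ, e⟫) / lam ≤ (‖ξ‖ - ⟪ξ, e⟫) / d := by gcongr
      _ ≤ _ := by
        gcongr
        nlinarith [Real.pi_gt_three]
  have : -(2/lam) * ‖ξ‖ = -((‖ξ‖ + ⟪ξ, e⟫) / lam) - (‖ξ‖ - ⟪ξ, e⟫) / lam := by ring
  linarith

/-- Splitting of the space along a unit vector. -/
lemma split_mp (e : E n) (he : ‖e‖ = 1) :
    ∃ Ψ : (ℝ × (ℝ ∙ e)ᗮ) ≃ᵐ E n, MeasurePreserving Ψ (volume.prod volume) volume ∧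
      ∀ p, Ψ p = p.1 • e + (p.2 : E n) := by
  let T := LinearIsometryEquiv.toSpanUnitSingleton (𝕜 := ℝ) e he
  let A1 : (ℝ × (ℝ ∙ e)ᗮ) ≃ᵐ ((ℝ ∙ e) × (ℝ ∙ e)ᗮ) :=
    MeasurableEquiv.prodCongr T.toHomeomorph.toMeasurableEquiv (MeasurableEquiv.refl _)
  have hA1 : MeasurePreserving A1 (volume.prod volume) (volume.prod volume) :=
    T.measurePreserving.prod (MeasurePreserving.id _)
  let O := (ℝ ∙ e).orthogonalDecomposition
  refine ⟨A1.trans ((MeasurableEquiv.toLp 2 _).trans O.symm.toHomeomorph.toMeasurableEquiv),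
    ?_, ?_⟩
  · exact (O.symm.measurePreserving.comp (WithLp.volume_preserving_toLp _ _)).comp hA1
  · intro p
    change O.symm (WithLp.toLp 2 (T p.1, p.2)) = _
    simp [O, T]

lemma lower_Z (lam d t x1 r : ℝ) (hd : 0 < d) (hdl : d ≤ lam) (P Q : ℂ)
    (hP : P = ((1/lam : ℝ):ℂ) - ((π * (t + x1) : ℝ):ℂ) * Complex.I)
    (hQ : Q = ((π/d : ℝ):ℂ) - ((π * (t - x1) : ℝ):ℂ) * Complex.I) :
    (1 + d * |t|) / (2 * (lam * d)) ≤ ‖P * Q + π^2 * r^2‖ := by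
  have hl : 0 < lam := hd.trans_le hdl
  have hπ := Real.pi_gt_three
  have hQre : Q.re = π/d := by rw [hQ]; simp
  have hQim : Q.im = -(π * (t - x1)) := by rw [hQ]; simp
  have hPre : P.re = 1/lam := by rw [hP]; simp
  have hPim : P.im = -(π * (t + x1)) := by rw [hP]; simp
  have hQ0 : Q ≠ 0 := by
    intro h
    have h0 : 0 < Q.re := by rw [hQre]; positivity
    rw [h] at h0
    simp at h0
  set Z := P * Q + π^2 * r^2 with hZ
  set W := P + π^2 * r^2 / Q with hW
  have hZW : Z = W * Q := by rw [hZ, hW]; field_simp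
  have hWre : 1/lam ≤ W.re := by
    have h1 : (π^2*r^2/Q : ℂ).re = π^2*r^2 * (Q.re / Complex.normSq Q) := by
      rw [div_eq_mul_inv, show (π^2*r^2 : ℂ) = ((π^2*r^2 : ℝ):ℂ) by push_cast; rfl,
        Complex.re_ofReal_mul, Complex.inv_re]
    rw [hW, Complex.add_re, h1, hPre, hQre]
    have := Complex.normSq_pos.2 hQ0
    have : 0 ≤ π^2*r^2 * (π / d / Complex.normSq Q) := by positivity
    linarith
  have hWn : 1/lam ≤ ‖W‖ := hWre.trans ((le_abs_self _).trans (Complex.abs_re_le_norm W))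
  have hQ1 : π/d ≤ ‖Q‖ := by
    rw [← hQre]; exact (le_abs_self _).trans (Complex.abs_re_le_norm Q)
  have hQ2 : π * |t - x1| ≤ ‖Q‖ := by
    have := Complex.abs_im_le_norm Q
    rwa [hQim, abs_neg, abs_mul, abs_of_pos Real.pi_pos] at this
  have hZn : ‖Z‖ = ‖W‖ * ‖Q‖ := by rw [hZW, norm_mul]
  have h1 : 1/lam * (π/d) ≤ ‖Z‖ := by rw [hZn]; gcongr
  have h2 : 1/lam * (π * |t - x1|) ≤ ‖Z‖ := by rw [hZn]; gcongr
  have him : Z.im = -(π/lam * (t - x1) + π^2/d * (t + x1)) := by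
    have h3 : (π^2*r^2 : ℂ).im = 0 := by
      rw [show (π^2*r^2 : ℂ) = ((π^2*r^2 : ℝ):ℂ) by push_cast; rfl, Complex.ofReal_im]
    rw [hZ, Complex.add_im, h3, Complex.mul_im, hPre, hPim, hQre, hQim]
    ring
  have h3 : π^2/d * |t + x1| - π/lam * |t - x1| ≤ ‖Z‖ := by
    have := Complex.abs_im_le_norm Z
    rw [him, abs_neg] at this
    have h4 := abs_sub_abs_le_abs_sub (π^2/d * (t + x1)) (-(π/lam * (t - x1)))
    rw [sub_neg_eq_add, abs_neg, abs_mul, abs_mul, abs_of_pos (by positivity : 0 < π^2/d),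
      abs_of_pos (by positivity : 0 < π/lam), add_comm (π^2/d * (t + x1))] at h4
    linarith
  have h4 : π^2/lam * |t + x1| ≤ π^2/d * |t + x1| := by gcongr
  have h5 : 2 * |t| ≤ |t + x1| + |t - x1| := by
    have := abs_add_le (t + x1) (t - x1)
    rw [show t + x1 + (t - x1) = 2 * t by ring, abs_mul] at this
    simpa using this
  -- multiply by lam
  have k1 : π / d ≤ lam * ‖Z‖ := by
    have := mul_le_mul_of_nonneg_left h1 hl.le
    field_simp at this ⊢; linarith
  have k2 : π * |t - x1| ≤ lam * ‖Z‖ := by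
    have := mul_le_mul_of_nonneg_left h2 hl.le
    field_simp at this ⊢; linarith
  have k3 : π^2 * |t + x1| - π * |t - x1| ≤ lam * ‖Z‖ := by
    have := mul_le_mul_of_nonneg_left ((sub_le_sub_right h4 _).trans h3) hl.le
    field_simp at this ⊢; linarith
  have k4 : |t + x1| ≤ lam * ‖Z‖ := by
    have h9 : 9 * |t + x1| ≤ π^2 * |t + x1| := by gcongr; nlinarith
    linarith [abs_nonneg (t + x1)]
  have k5 : |t - x1| ≤ lam * ‖Z‖ := by nlinarith [abs_nonneg (t - x1)]
  have k6 : 1 / d ≤ lam * ‖Z‖ := by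
    refine le_trans ?_ k1
    gcongr; linarith
  have k7 : 1 / d + |t| ≤ 2 * (lam * ‖Z‖) := by linarith
  rw [div_le_iff₀ (by positivity)]
  have : 1 + d * |t| = d * (1/d + |t|) := by field_simp
  rw [this]
  nlinarith

lemma kern_E (hn : 2 ≤ n) : ∃ C : ℝ, 0 ≤ C ∧ ∀ (e : E n), ‖e‖ = 1 → ∀ lam d : ℝ, 0 < d → d ≤ lam →
    ∀ (t : ℝ) (x : E n),
    ‖∫ ξ : E n, (wt e lam d ξ : ℂ) * eC (2 * π * ⟪x, ξ⟫ + 2 * π * t * ‖ξ‖)‖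
      ≤ C * (lam * d) ^ (((n:ℝ) - 1)/2) * (1 + d * |t|) ^ (-(((n:ℝ) - 1)/2)) := by
  obtain ⟨C, hC, hK⟩ := kern_F (n - 1) (by omega)
  refine ⟨C * 2 ^ (((n:ℝ) - 1)/2), by positivity, ?_⟩
  intro e he lam d hd hdl t x
  have hl : 0 < lam := hd.trans_le hdl
  obtain ⟨Ψ, hΨ, hΨe⟩ := split_mp e he
  set P : ℂ := ((1/lam : ℝ):ℂ) - ((π * (t + ⟪x, e⟫) : ℝ):ℂ) * Complex.I with hP
  set Q : ℂ := ((π/d : ℝ):ℂ) - ((π * (t - ⟪x, e⟫) : ℝ):ℂ) * Complex.I with hQ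
  have hfin : Module.finrank ℝ (ℝ ∙ e)ᗮ = n - 1 := by
    have : Fact (Module.finrank ℝ (E n) = (n - 1) + 1) := ⟨by simp; omega⟩
    exact Submodule.finrank_orthogonal_span_singleton (by rintro rfl; simp at he)
  set z : (ℝ ∙ e)ᗮ := (ℝ ∙ e)ᗮ.orthogonalProjectionOnto x with hz
  have hIntg : Integrable (fun ξ : E n => (wt e lam d ξ : ℂ) *
      eC (2 * π * ⟪x, ξ⟫ + 2 * π * t * ‖ξ‖)) := by
    refine Integrable.mul_bdd (c := 1) (wt_int hn e he lam d hd hdl).ofReal ?_ ?_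
    · exact (eC_cont.comp (by fun_prop)).aestronglyMeasurable
    · exact ae_of_all _ fun ξ => (eC_norm _).le
  have hcomp := (hΨ.integrable_comp_emb Ψ.measurableEmbedding).2 hIntg
  have hPre : 0 < P.re := by rw [hP]; simp; positivity
  have hQre : 0 < Q.re := by rw [hQ]; simp; positivity
  simp only [Function.comp_def] at hcomp
  rw [← hΨ.integral_comp Ψ.measurableEmbedding, integral_prod_symm _ hcomp]
  have hpt : ∀ (v : (ℝ ∙ e)ᗮ) (a : ℝ), (wt e lam d (Ψ (a, v)) : ℂ) *
      eC (2 * π * ⟪x, Ψ (a, v)⟫ + 2 * π * t * ‖Ψ (a, v)‖)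
      = (Complex.exp (-P * ((√(a^2+‖v‖^2) + a : ℝ):ℂ) - Q * ((√(a^2+‖v‖^2) - a : ℝ):ℂ))
        * ((1 / √(a^2+‖v‖^2) : ℝ) : ℂ)) * Complex.exp (2 * π * Complex.I * (⟪z, v⟫ : ℝ)) := by
    intro v a
    have hve : ⟪(v : E n), e⟫ = 0 := by
      rw [real_inner_comm]
      exact Submodule.mem_orthogonal_singleton_iff_inner_right.1 v.2
    have hnorm : ‖a • e + (v : E n)‖ = √(a^2+‖v‖^2) := by
      rw [eq_comm, Real.sqrt_eq_iff_mul_self_eq (by positivity) (norm_nonneg _),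
        norm_add_mul_self_real, inner_smul_left, real_inner_comm, hve, norm_smul, he]
      simp
      ring
    have hin : ⟪a • e + (v : E n), e⟫ = a := by
      rw [inner_add_left, hve, inner_smul_left, real_inner_self_eq_norm_sq, he]; simp
    have hxz : ⟪x, (v : E n)⟫ = ⟪z, v⟫ := by
      rw [hz, Submodule.inner_orthogonalProjectionOnto_eq_of_mem_right]
    rw [hΨe]
    simp only [wt, hnorm, hin, inner_add_right, inner_smul_right, hxz]
    set N := √(a^2+‖v‖^2)
    unfold eC
    push_cast
    rw [mul_right_comm, ← Complex.exp_add]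
    conv_rhs => rw [mul_right_comm, ← Complex.exp_add]
    congr 2
    rw [hP, hQ]
    push_cast
    ring
  simp_rw [hpt]
  have h1 := hK P Q hPre hQre z hfin
  have h2 := lower_Z lam d t ⟪x, e⟫ ‖z‖ hd hdl P Q hP hQ
  have hcast : ((n - 1 : ℕ) : ℝ) = (n:ℝ) - 1 := by rw [Nat.cast_sub (by omega)]; simp
  rw [hcast] at h1
  have hnn : 0 ≤ ((n:ℝ) - 1)/2 := by
    have : (2:ℝ) ≤ n := by exact_mod_cast hn
    linarith
  have h3 : 0 < 1 + d * |t| := by positivity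
  refine h1.trans ?_
  calc _ ≤ C * ((1 + d * |t|) / (2 * (lam * d))) ^ (-(((n:ℝ) - 1)/2)) := by
        refine mul_le_mul_of_nonneg_left ?_ hC
        exact Real.rpow_le_rpow_of_nonpos (by positivity) h2 (by linarith)
    _ = _ := by
        rw [Real.div_rpow h3.le (by positivity), Real.rpow_neg (by positivity : 0 ≤ 2 * (lam * d)),
          Real.mul_rpow (by norm_num) (by positivity)]
        field_simp



lemma ttstar_fin {α Ω : Type*} [MeasurableSpace α] [MeasurableSpace Ω] (ν : Measure α)
    [IsFiniteMeasure ν] (μ : Measure Ω) [SFinite μ] (e : α → Ω → ℂ)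
    (he : Measurable (Function.uncurry e)) (he1 : ∀ t ω, ‖e t ω‖ = 1)
    (w : Ω → ℝ) (hw0 : ∀ ω, 0 ≤ w ω) (hwi : Integrable w μ)
    (g : Ω → ℂ) (hgi : Integrable g μ) (hg2 : Integrable (fun ω => ‖g ω‖ ^ 2) μ)
    (c : ℝ) (hc : 0 < c) (hcw : ∀ ω, g ω ≠ 0 → c ≤ w ω) (M : ℝ) (hM : 0 < M)
    (hK : ∀ t, ∫ s, ‖∫ ω, (w ω : ℂ) * (e t ω * starRingEnd ℂ (e s ω)) ∂μ‖ ∂ν ≤ M) :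
    ∫ t, ‖∫ ω, e t ω * g ω ∂μ‖ ^ 2 ∂ν ≤ c⁻¹ * M * ∫ ω, ‖g ω‖ ^ 2 ∂μ := by
  set G : α → ℂ := fun t => ∫ ω, e t ω * g ω ∂μ with hG
  set K : α → α → ℂ := fun t s => ∫ ω, (w ω : ℂ) * (e t ω * starRingEnd ℂ (e s ω)) ∂μ with hKdef
  set B : ℝ := ∫ ω, ‖g ω‖ ∂μ with hB
  set W : ℝ := ∫ ω, w ω ∂μ with hW
  have hstar : Measurable (starRingEnd ℂ) := Complex.continuous_conj.measurable
  -- measurability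
  have hGm : AEStronglyMeasurable G ν := by
    have : AEStronglyMeasurable (fun p : α × Ω => e p.1 p.2 * g p.2) (ν.prod μ) :=
      (he.aestronglyMeasurable).mul hgi.aestronglyMeasurable.comp_snd
    exact this.integral_prod_right'
  have hGb : ∀ t, ‖G t‖ ≤ B := by
    intro t
    refine (norm_integral_le_integral_norm _).trans (le_of_eq ?_)
    simp [he1, hB]
  have hB0 : 0 ≤ B := integral_nonneg fun _ => norm_nonneg _
  have hKm : AEStronglyMeasurable (fun p : α × α => K p.1 p.2) (ν.prod ν) := by
    have : AEStronglyMeasurable (fun q : (α × α) × Ω =>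
        (w q.2 : ℂ) * (e q.1.1 q.2 * starRingEnd ℂ (e q.1.2 q.2))) ((ν.prod ν).prod μ) := by
      refine AEStronglyMeasurable.mul ?_ (Measurable.aestronglyMeasurable ?_)
      · exact (hwi.ofReal (𝕜 := ℂ)).aestronglyMeasurable.comp_snd
      · have h1 : Measurable (fun q : (α × α) × Ω => e q.1.1 q.2) :=
          he.comp ((measurable_fst.comp measurable_fst).prodMk measurable_snd)
        have h2 : Measurable (fun q : (α × α) × Ω => e q.1.2 q.2) :=
          he.comp ((measurable_snd.comp measurable_fst).prodMk measurable_snd)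
        exact h1.mul (hstar.comp h2)
    exact this.integral_prod_right'
  have hKb : ∀ t s, ‖K t s‖ ≤ W := by
    intro t s
    refine (norm_integral_le_integral_norm _).trans (le_of_eq ?_)
    simp [he1, hW, abs_of_nonneg, hw0]
  have hKs : ∀ t s, ‖K t s‖ = ‖K s t‖ := by
    intro t s
    have : K t s = starRingEnd ℂ (K s t) := by
      rw [hKdef]
      simp only
      rw [← integral_conj]
      congr 1; ext ω
      simp [mul_comm]
    rw [this, Complex.norm_conj]
  set Φ : Ω → ℂ := fun ω => ∫ t, starRingEnd ℂ (G t) * e t ω ∂ν with hΦ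
  set I : ℝ := ∫ t, ‖G t‖ ^ 2 ∂ν with hI
  have hI0 : 0 ≤ I := integral_nonneg fun _ => by positivity
  have hGi : Integrable G ν := Integrable.of_bound hGm B (ae_of_all _ hGb)
  have hGcm : AEStronglyMeasurable (fun t => starRingEnd ℂ (G t)) ν :=
    Complex.continuous_conj.comp_aestronglyMeasurable hGm
  have hG2i : Integrable (fun t => ‖G t‖ ^ 2) ν :=
    Integrable.of_bound (hGm.norm.pow 2) (B ^ 2) (ae_of_all _ fun t => by
      rw [Real.norm_of_nonneg (by positivity)]
      exact pow_le_pow_left₀ (norm_nonneg _) (hGb t) 2)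
  -- step 1
  have hF1 : Integrable (fun p : α × Ω => starRingEnd ℂ (G p.1) * (e p.1 p.2 * g p.2))
      (ν.prod μ) := by
    have h0 : Integrable (fun p : α × Ω => (B * ‖g p.2‖ : ℝ)) (ν.prod μ) := by
      have := (integrable_const (μ := ν) B).mul_prod hgi.norm
      exact this
    refine h0.mono' ?_ (ae_of_all _ fun p => ?_)
    · exact hGcm.comp_fst.mul ((he.aestronglyMeasurable).mul hgi.aestronglyMeasurable.comp_snd)
    · rw [norm_mul, norm_mul, he1, one_mul, Complex.norm_conj]
      exact mul_le_mul_of_nonneg_right (hGb _) (norm_nonneg _)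
  have h1 : (I : ℂ) = ∫ ω, g ω * Φ ω ∂μ := by
    calc (I : ℂ) = ∫ t, starRingEnd ℂ (G t) * G t ∂ν := by
          rw [hI, ← integral_complex_ofReal]
          congr 1; ext t
          rw [mul_comm, Complex.mul_conj, Complex.normSq_eq_norm_sq]
      _ = ∫ t, ∫ ω, starRingEnd ℂ (G t) * (e t ω * g ω) ∂μ ∂ν := by
          congr 1; ext t
          rw [integral_const_mul]
      _ = ∫ ω, ∫ t, starRingEnd ℂ (G t) * (e t ω * g ω) ∂ν ∂μ := integral_integral_swap hF1
      _ = _ := by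
          congr 1; ext ω
          rw [hΦ, ← integral_const_mul]
          congr 1; ext t; ring
  -- step 3
  have hF3 : Integrable (fun q : (α × α) × Ω => (starRingEnd ℂ (G q.1.1) * G q.1.2) *
      ((w q.2 : ℂ) * (e q.1.1 q.2 * starRingEnd ℂ (e q.1.2 q.2)))) ((ν.prod ν).prod μ) := by
    have h0 : Integrable (fun q : (α × α) × Ω => (B * B * w q.2 : ℝ)) ((ν.prod ν).prod μ) := by
      have := (integrable_const (μ := ν.prod ν) (B * B)).mul_prod hwi
      exact this
    refine h0.mono' ?_ (ae_of_all _ fun q => ?_)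
    · refine AEStronglyMeasurable.mul ?_ (AEStronglyMeasurable.mul ?_
        (Measurable.aestronglyMeasurable ?_))
      · exact (hGcm.comp_fst.mul hGm.comp_snd : AEStronglyMeasurable
          (fun p : α × α => starRingEnd ℂ (G p.1) * G p.2) (ν.prod ν)).comp_fst
      · exact (hwi.ofReal (𝕜 := ℂ)).aestronglyMeasurable.comp_snd
      · have h1 : Measurable (fun q : (α × α) × Ω => e q.1.1 q.2) :=
          he.comp ((measurable_fst.comp measurable_fst).prodMk measurable_snd)
        have h2 : Measurable (fun q : (α × α) × Ω => e q.1.2 q.2) :=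
          he.comp ((measurable_snd.comp measurable_fst).prodMk measurable_snd)
        exact h1.mul (hstar.comp h2)
    · simp only [norm_mul, he1, Complex.norm_conj, mul_one, Complex.norm_real, Real.norm_eq_abs,
        abs_of_nonneg (hw0 _)]
      exact mul_le_mul_of_nonneg_right (mul_le_mul (hGb _) (hGb _) (norm_nonneg _) hB0) (hw0 _)
  have hwΦpt : ∀ ω, ∫ p, (starRingEnd ℂ (G p.1) * G p.2) *
      ((w ω : ℂ) * (e p.1 ω * starRingEnd ℂ (e p.2 ω))) ∂(ν.prod ν)
      = ((w ω * ‖Φ ω‖ ^ 2 : ℝ) : ℂ) := by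
    intro ω
    have : ∀ p : α × α, (starRingEnd ℂ (G p.1) * G p.2) *
      ((w ω : ℂ) * (e p.1 ω * starRingEnd ℂ (e p.2 ω))) =
      (w ω : ℂ) * ((starRingEnd ℂ (G p.1) * e p.1 ω) *
        (starRingEnd ℂ (starRingEnd ℂ (G p.2) * e p.2 ω))) := by
      intro p; simp; ring
    simp_rw [this]
    rw [integral_const_mul, integral_prod_mul (fun t => starRingEnd ℂ (G t) * e t ω)
      (fun t => starRingEnd ℂ (starRingEnd ℂ (G t) * e t ω)), integral_conj]
    rw [Complex.mul_conj, Complex.normSq_eq_norm_sq]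
    push_cast; rfl
  have hwΦi : Integrable (fun ω => w ω * ‖Φ ω‖ ^ 2) μ := by
    have := hF3.integral_prod_right
    simp only [hwΦpt] at this
    exact this.re
  have h3 : ((∫ ω, w ω * ‖Φ ω‖ ^ 2 ∂μ : ℝ) : ℂ) =
      ∫ p, (starRingEnd ℂ (G p.1) * G p.2) * K p.1 p.2 ∂(ν.prod ν) := by
    rw [← integral_complex_ofReal]
    simp_rw [← hwΦpt]
    rw [← integral_integral_swap hF3]
    congr 1; ext p
    rw [integral_const_mul]
  -- step 4
  have hJ : Integrable (fun p : α × α => ‖G p.1‖ ^ 2 * ‖K p.1 p.2‖) (ν.prod ν) := by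
    refine Integrable.of_bound ((hGm.comp_fst.norm.pow 2).mul hKm.norm) (B ^ 2 * W)
      (ae_of_all _ fun p => ?_)
    rw [Real.norm_of_nonneg (by positivity)]
    exact mul_le_mul (pow_le_pow_left₀ (norm_nonneg _) (hGb _) 2) (hKb _ _) (norm_nonneg _)
      (by positivity)
  have hJ' : Integrable (fun p : α × α => ‖G p.2‖ ^ 2 * ‖K p.1 p.2‖) (ν.prod ν) := by
    have := hJ.swap
    refine this.congr (ae_of_all _ fun p => ?_)
    simp [hKs p.2 p.1]
  have hJJ : ∫ p, ‖G p.2‖ ^ 2 * ‖K p.1 p.2‖ ∂(ν.prod ν) =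
      ∫ p, ‖G p.1‖ ^ 2 * ‖K p.1 p.2‖ ∂(ν.prod ν) := by
    rw [← integral_prod_swap]
    congr 1; ext p
    simp [hKs p.2 p.1]
  have hJle : ∫ p, ‖G p.1‖ ^ 2 * ‖K p.1 p.2‖ ∂(ν.prod ν) ≤ I * M := by
    rw [integral_prod _ hJ, hI, ← integral_mul_const]
    refine integral_mono hJ.integral_prod_left (hG2i.mul_const _) fun t => ?_
    simp only
    rw [integral_const_mul]
    exact mul_le_mul_of_nonneg_left (hK t) (by positivity)
  have h4 : ∫ ω, w ω * ‖Φ ω‖ ^ 2 ∂μ ≤ I * M := by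
    have h0 : 0 ≤ ∫ ω, w ω * ‖Φ ω‖ ^ 2 ∂μ :=
      integral_nonneg fun ω => mul_nonneg (hw0 ω) (by positivity)
    calc ∫ ω, w ω * ‖Φ ω‖ ^ 2 ∂μ = ‖((∫ ω, w ω * ‖Φ ω‖ ^ 2 ∂μ : ℝ) : ℂ)‖ := by
          rw [Complex.norm_real, Real.norm_of_nonneg h0]
      _ ≤ ∫ p, (‖G p.1‖ ^ 2 * ‖K p.1 p.2‖ + ‖G p.2‖ ^ 2 * ‖K p.1 p.2‖) / 2 ∂(ν.prod ν) := by
          rw [h3]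
          refine norm_integral_le_of_norm_le ((hJ.add hJ').div_const 2) (ae_of_all _ fun p => ?_)
          rw [norm_mul, norm_mul, Complex.norm_conj]
          nlinarith [mul_nonneg (sq_nonneg (‖G p.1‖ - ‖G p.2‖)) (norm_nonneg (K p.1 p.2))]
      _ = ∫ p, ‖G p.1‖ ^ 2 * ‖K p.1 p.2‖ ∂(ν.prod ν) := by
          rw [integral_div, integral_add hJ hJ', hJJ]; ring
      _ ≤ _ := hJle
  -- conclusion
  set D : ℝ := c⁻¹ * M with hD
  have hD0 : 0 < D := by positivity
  have h5 : I ≤ ∫ ω, (D / 2 * ‖g ω‖ ^ 2 + (2 * M)⁻¹ * (w ω * ‖Φ ω‖ ^ 2)) ∂μ := by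
    calc I = ‖(I : ℂ)‖ := by rw [Complex.norm_real, Real.norm_of_nonneg hI0]
      _ ≤ _ := by
        rw [h1]
        refine norm_integral_le_of_norm_le ((hg2.const_mul _).add (hwΦi.const_mul _))
          (ae_of_all _ fun ω => ?_)
        rw [norm_mul]
        by_cases hgz : g ω = 0
        · simp only [hgz, norm_zero, zero_mul]
          have := hw0 ω
          positivity
        · have hcw' := hcw ω hgz
          have e1 : D / 2 * ‖g ω‖ ^ 2 + (2 * M)⁻¹ * (c * ‖Φ ω‖ ^ 2) - ‖g ω‖ * ‖Φ ω‖
              = (2 * M)⁻¹ * c * (D * ‖g ω‖ - ‖Φ ω‖) ^ 2 := by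
            rw [hD]; field_simp; ring
          have e2 : 0 ≤ (2 * M)⁻¹ * c * (D * ‖g ω‖ - ‖Φ ω‖) ^ 2 := by positivity
          have e3 : (2 * M)⁻¹ * (c * ‖Φ ω‖ ^ 2) ≤ (2 * M)⁻¹ * (w ω * ‖Φ ω‖ ^ 2) := by gcongr
          linarith
  rw [integral_add (hg2.const_mul _) (hwΦi.const_mul _), integral_const_mul,
    integral_const_mul] at h5
  have h6 : (2 * M)⁻¹ * ∫ ω, w ω * ‖Φ ω‖ ^ 2 ∂μ ≤ I / 2 := by
    calc _ ≤ (2 * M)⁻¹ * (I * M) := by gcongr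
      _ = I / 2 := by field_simp
  linarith

lemma lsc_bound (G : ℝ → E n → ℂ) (hGm : ∀ x, Measurable fun t => G t x)
    (hc : ∀ t, Continuous (G t)) (B : ℝ) (hb : ∀ t x, ‖G t x‖ ≤ B) (Q : ℝ≥0∞)
    (h : ∀ X : ℝ → E n, Measurable X → ∫⁻ t, ‖G t (X t)‖ₑ ^ 2 ≤ Q) :
    LqLr 2 ⊤ G ≤ 2 * Q ^ ((1:ℝ)/2) := by
  classical
  set x := TopologicalSpace.denseSeq (E n) with hx
  set N : ℝ → ℝ := fun t => ⨆ k, ‖G t (x k)‖ with hN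
  have hbdd : ∀ t, BddAbove (Set.range fun k => ‖G t (x k)‖) := fun t =>
    ⟨B, by rintro _ ⟨k, rfl⟩; exact hb t _⟩
  have hNm : Measurable N := Measurable.iSup fun k => (hGm (x k)).norm
  have hex : ∀ t, ∃ k, N t / 2 ≤ ‖G t (x k)‖ := by
    intro t
    have h0 : 0 ≤ N t := Real.iSup_nonneg fun _ => norm_nonneg _
    rcases h0.eq_or_lt with h0 | h0
    · exact ⟨0, by rw [← h0]; simp⟩
    · obtain ⟨k, hk⟩ := exists_lt_of_lt_ciSup (show N t / 2 < ⨆ k, ‖G t (x k)‖ by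
        change N t / 2 < N t; linarith)
      exact ⟨k, hk.le⟩
  set X : ℝ → E n := fun t => x (Nat.find (hex t)) with hX
  have hXm : Measurable X := by
    refine (measurable_from_nat (f := x)).comp (measurable_find hex fun k => ?_)
    exact measurableSet_le (hNm.div_const 2) (hGm (x k)).norm
  have hpt : ∀ t, (eLpNorm (G t) ⊤ volume).toReal ≤ 2 * ‖G t (X t)‖ := by
    intro t
    have h1 : ∀ y, ‖G t y‖ ≤ N t := by
      intro y
      have hcl : IsClosed {y | ‖G t y‖ ≤ N t} := isClosed_le (hc t).norm continuous_const
      have hd : Dense {y | ‖G t y‖ ≤ N t} :=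
        (TopologicalSpace.denseRange_denseSeq (E n)).mono (by
          rintro _ ⟨k, rfl⟩; exact le_ciSup (hbdd t) k)
      have := hd.closure_eq
      rw [hcl.closure_eq] at this
      exact (Set.eq_univ_iff_forall.1 this) y
    have h0 : 0 ≤ N t := (norm_nonneg _).trans (h1 0)
    have h2 : eLpNorm (G t) ⊤ volume ≤ ENNReal.ofReal (N t) := by
      rw [eLpNorm_exponent_top]
      exact eLpNormEssSup_le_of_ae_bound (ae_of_all _ h1)
    have h3 := ENNReal.toReal_mono ENNReal.ofReal_ne_top h2
    rw [ENNReal.toReal_ofReal h0] at h3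
    have h4 := Nat.find_spec (hex t)
    change N t / 2 ≤ ‖G t (X t)‖ at h4
    linarith
  unfold LqLr
  have h5 : eLpNorm (fun t => (eLpNorm (G t) ⊤ volume).toReal) 2 volume ≤
      eLpNorm (fun t => (2:ℝ) • ‖G t (X t)‖) 2 volume := by
    refine eLpNorm_mono_real fun t => ?_
    rw [Real.norm_of_nonneg ENNReal.toReal_nonneg]
    exact hpt t
  refine h5.trans ?_
  have h6 : eLpNorm (fun t => (2:ℝ) • ‖G t (X t)‖) 2 volume =
      2 * eLpNorm (fun t => ‖G t (X t)‖) 2 volume := by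
    have := eLpNorm_const_smul (2:ℝ) (fun t => ‖G t (X t)‖) 2 (volume : Measure ℝ)
    refine this.trans ?_
    congr 1
    rw [Real.enorm_eq_ofReal (by norm_num)]; simp
  rw [h6]
  gcongr
  rw [eLpNorm_norm, eLpNorm_eq_lintegral_rpow_enorm_toReal (by norm_num) (by norm_num)]
  simp only [ENNReal.toReal_ofNat]
  gcongr
  refine le_trans (le_of_eq ?_) (h X hXm)
  congr 1; ext t
  norm_cast

lemma ttstar_E (w : E n → ℝ) (hw0 : ∀ ξ, 0 ≤ w ξ) (hwi : Integrable w)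
    (g : E n → ℂ) (hgi : Integrable g) (hg2 : Integrable (fun ξ => ‖g ξ‖ ^ 2))
    (c : ℝ) (hc : 0 < c) (hcw : ∀ ξ, g ξ ≠ 0 → c ≤ w ξ) (σ : ℝ)
    (k : ℝ → ℝ) (hk0 : ∀ t, 0 ≤ k t) (hki : Integrable k) (hkM : 0 < ∫ t, k t)
    (hK : ∀ t x, ‖∫ ξ, (w ξ : ℂ) * eC (2 * π * ⟪x, ξ⟫ + 2 * π * (σ * t) * ‖ξ‖)‖ ≤ k t)
    (X : ℝ → E n) (hX : Measurable X) :
    ∫⁻ t, ‖∫ ξ, eC (2 * π * ⟪X t, ξ⟫) * (eC (σ * 2 * π * t * ‖ξ‖) * g ξ)‖ₑ ^ 2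
      ≤ ENNReal.ofReal (c⁻¹ * (∫ t, k t) * ∫ ξ, ‖g ξ‖ ^ 2) := by
  set e : ℝ → E n → ℂ := fun t ξ => eC (2 * π * ⟪X t, ξ⟫ + 2 * π * (σ * t) * ‖ξ‖) with he
  have hem : Measurable (Function.uncurry e) := by
    refine eC_cont.measurable.comp ?_
    have h1 : Measurable fun p : ℝ × E n => ⟪X p.1, p.2⟫ :=
      (hX.comp measurable_fst).inner measurable_snd
    fun_prop
  have he1 : ∀ t ξ, ‖e t ξ‖ = 1 := fun t ξ => eC_norm _
  have hGe : ∀ t, ∫ ξ, eC (2 * π * ⟪X t, ξ⟫) * (eC (σ * 2 * π * t * ‖ξ‖) * g ξ)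
      = ∫ ξ, e t ξ * g ξ := by
    intro t; congr 1; ext ξ
    rw [he]; simp only
    rw [eC_add, ← mul_assoc]
    congr 3; ring
  simp_rw [hGe]
  have hGm : AEStronglyMeasurable (fun t => ∫ ξ, e t ξ * g ξ) volume := by
    have : AEStronglyMeasurable (fun p : ℝ × E n => e p.1 p.2 * g p.2) (volume.prod volume) :=
      (hem.aestronglyMeasurable).mul hgi.aestronglyMeasurable.comp_snd
    exact this.integral_prod_right'
  have hGb : ∀ t, ‖∫ ξ, e t ξ * g ξ‖ ≤ ∫ ξ, ‖g ξ‖ := by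
    intro t
    refine (norm_integral_le_integral_norm _).trans (le_of_eq ?_)
    simp [he1]
  have hcov : AECover (volume : Measure ℝ) atTop (fun N : ℕ => Set.Icc (-(N:ℝ)) N) :=
    aecover_Icc (tendsto_neg_atTop_atBot.comp tendsto_natCast_atTop_atTop)
      tendsto_natCast_atTop_atTop
  refine le_of_tendsto' (hcov.lintegral_tendsto_of_countably_generated
    (hGm.enorm.pow_const 2)) fun N => ?_
  set ν : Measure ℝ := volume.restrict (Set.Icc (-(N:ℝ)) N) with hν
  have hmain := ttstar_fin ν volume e hem he1 w hw0 hwi g hgi hg2 c hc hcw (∫ t, k t) hkM ?_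
  · refine le_trans (le_of_eq ?_) (ENNReal.ofReal_le_ofReal hmain)
    rw [ofReal_integral_eq_lintegral_ofReal]
    · congr 1; ext t
      rw [← ofReal_norm, ENNReal.ofReal_pow (norm_nonneg _)]
    · refine Integrable.of_bound (hGm.restrict.norm.pow 2) ((∫ ξ, ‖g ξ‖) ^ 2)
        (ae_of_all _ fun t => ?_)
      rw [Real.norm_of_nonneg (by positivity)]
      exact pow_le_pow_left₀ (norm_nonneg _) (hGb t) 2
    · exact ae_of_all _ fun t => by positivity
  · intro t
    have hkt : Integrable (fun s => k (t - s)) := hki.comp_sub_left t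
    calc _ ≤ ∫ s, k (t - s) ∂ν := by
          refine integral_mono_of_nonneg (ae_of_all _ fun _ => norm_nonneg _) hkt.restrict
            (ae_of_all _ fun s => ?_)
          simp only
          refine le_trans (le_of_eq ?_) (hK (t - s) (X t - X s))
          congr 2; ext ξ
          rw [he]; simp only
          rw [eC_conj, ← eC_add, inner_sub_left]
          congr 2; ring
      _ ≤ ∫ s, k (t - s) := setIntegral_le_integral hkt (ae_of_all _ fun s => hk0 _)
      _ = ∫ s, k s := integral_sub_left_eq_self k volume t

lemma k_int (p : ℝ) (hp : 1 < p) : ∃ J : ℝ, 0 < J ∧ ∀ d : ℝ, 0 < d →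
    Integrable (fun t : ℝ => (1 + d * |t|) ^ (-p)) ∧ ∫ t : ℝ, (1 + d * |t|) ^ (-p) = J / d := by
  have hi : Integrable (fun t : ℝ => (1 + ‖t‖) ^ (-p)) :=
    integrable_one_add_norm (by simpa using hp)
  refine ⟨∫ t : ℝ, (1 + ‖t‖) ^ (-p), ?_, fun d hd => ?_⟩
  · rw [integral_pos_iff_support_of_nonneg (fun t => by positivity) hi]
    have : Function.support (fun t : ℝ => (1 + ‖t‖) ^ (-p)) = Set.univ := by
      ext t; simp only [Function.mem_support, Set.mem_univ, iff_true]
      have : 0 < (1 + ‖t‖) ^ (-p) := by positivity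
      exact this.ne'
    rw [this]; simp
  · have hfun : (fun t : ℝ => (1 + d * |t|) ^ (-p)) = fun t => (fun s : ℝ => (1 + ‖s‖) ^ (-p)) (d * t) := by
      ext t; simp [abs_of_pos hd]
    rw [hfun]
    refine ⟨hi.comp_mul_left' hd.ne', ?_⟩
    rw [Measure.integral_comp_mul_left (fun s : ℝ => (1 + ‖s‖) ^ (-p)) d, abs_of_pos (by positivity),
      smul_eq_mul]
    field_simp

lemma wt_lower_pos (e : E n) (he : ‖e‖ = 1) (lam d : ℝ) (hd : 0 < d) (hdl : d ≤ lam) (ξ : E n)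
    (h1 : lam / 4 ≤ ‖ξ‖) (h2 : ‖ξ‖ ≤ 8 * lam) (h3 : ‖ξ - ⟪ξ, e⟫ • e‖ ≤ 8 * √(lam * d))
    (hpos : 0 ≤ ⟪ξ, e⟫) : rexp (-16 - 256 * π) / (8 * lam) ≤ wt e lam d ξ := by
  have hl : 0 < lam := hd.trans_le hdl
  have hξ : 0 < ‖ξ‖ := by linarith
  set a := ⟪ξ, e⟫ with ha
  have hale : a ≤ ‖ξ‖ := by
    have := real_inner_le_norm ξ e
    rwa [he, mul_one] at this
  have h4 : ‖ξ - a • e‖ ^ 2 = ‖ξ‖ ^ 2 - a ^ 2 := by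
    rw [norm_sub_sq_real, inner_smul_right, norm_smul, he, ← ha]
    simp; ring
  have h5 : ‖ξ‖ ^ 2 - a ^ 2 ≤ 64 * (lam * d) := by
    rw [← h4]
    calc _ ≤ (8 * √(lam * d)) ^ 2 := by gcongr
      _ = _ := by rw [mul_pow, Real.sq_sqrt (by positivity)]; norm_num
  have h6 : ‖ξ‖ - a ≤ 256 * d := by
    by_contra hcon
    push Not at hcon
    have : (lam / 4) * (256 * d) < (‖ξ‖ + a) * (‖ξ‖ - a) :=
      mul_lt_mul' (by linarith) hcon (by positivity) (by linarith)
    nlinarith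
  unfold wt
  rw [← ha, div_eq_mul_one_div]
  have h7 : (‖ξ‖ + a) / lam ≤ 16 := by rw [div_le_iff₀ hl]; linarith
  have h8 : π * (‖ξ‖ - a) / d ≤ 256 * π := by
    rw [div_le_iff₀ hd]; nlinarith [Real.pi_pos]
  gcongr

lemma wt_lower (e : E n) (he : ‖e‖ = 1) (lam d : ℝ) (hd : 0 < d) (hdl : d ≤ lam) (ξ : E n)
    (h1 : lam / 4 ≤ ‖ξ‖) (h2 : ‖ξ‖ ≤ 8 * lam) (h3 : ‖ξ - ⟪ξ, e⟫ • e‖ ≤ 8 * √(lam * d)) :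
    rexp (-16 - 256 * π) / (8 * lam) ≤ wt e lam d ξ + wt (-e) lam d ξ := by
  rcases le_total 0 ⟪ξ, e⟫ with h | h
  · have := wt_lower_pos e he lam d hd hdl ξ h1 h2 h3 h
    have := wt_nonneg (-e) lam d ξ
    linarith
  · have := wt_lower_pos (-e) (by simpa using he) lam d hd hdl ξ h1 h2 (by simpa using h3)
      (by simpa using h)
    have := wt_nonneg e lam d ξ
    linarith

lemma main_g (hn : 5 < n) : ∃ C : ℝ, 0 ≤ C ∧ ∀ e : E n, ‖e‖ = 1 → ∀ lam d : ℝ, 0 < d → d ≤ lam →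
    ∀ σ : ℝ, σ = 1 ∨ σ = -1 → ∀ g : E n → ℂ, Integrable g → Integrable (fun ξ => ‖g ξ‖ ^ 2) →
    (∀ ξ, g ξ ≠ 0 → lam / 4 ≤ ‖ξ‖ ∧ ‖ξ‖ ≤ 8 * lam ∧ ‖ξ - ⟪ξ, e⟫ • e‖ ≤ 8 * √(lam * d)) →
    LqLr 2 ⊤ (fun t x => ∫ ξ : E n, eC (2 * π * ⟪x, ξ⟫) * (eC (σ * 2 * π * t * ‖ξ‖) * g ξ))
      ≤ ENNReal.ofReal C * ENNReal.ofReal (lam ^ (((n:ℝ) + 1) / 4) * d ^ (((n:ℝ) - 3) / 4)) *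
        ENNReal.ofReal (∫ ξ, ‖g ξ‖ ^ 2) ^ ((1:ℝ)/2) := by
  obtain ⟨C, hC0, hC⟩ := kern_E (n := n) (by omega)
  have hn' : (6:ℝ) ≤ n := by exact_mod_cast hn
  obtain ⟨J, hJ0, hJ⟩ := k_int (((n:ℝ) - 1) / 2) (by linarith)
  set D : ℝ := 16 * rexp (16 + 256 * π) * (C + 1) * J with hD
  have hD0 : 0 < D := by positivity
  refine ⟨2 * √D, by positivity, ?_⟩
  intro e he lam d hd hdl σ hσ g hgi hg2 hsupp
  have hl : 0 < lam := hd.trans_le hdl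
  set p : ℝ := ((n:ℝ) - 1) / 2 with hp
  set a : ℝ := lam ^ (((n:ℝ) + 1) / 4) * d ^ (((n:ℝ) - 3) / 4) with ha
  set k : ℝ → ℝ := fun t => 2 * (C + 1) * (lam * d) ^ p * (1 + d * |t|) ^ (-p) with hk
  have hki : Integrable k := (hJ d hd).1.const_mul _
  have hkI : ∫ t, k t = 2 * (C + 1) * (lam * d) ^ p * (J / d) := by
    rw [hk, integral_const_mul, (hJ d hd).2]
  have hkM : 0 < ∫ t, k t := by rw [hkI]; positivity
  have he' : ‖-e‖ = 1 := by simpa using he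
  set w : E n → ℝ := fun ξ => wt e lam d ξ + wt (-e) lam d ξ with hw
  have hi1 := wt_int (n := n) (by omega) e he lam d hd hdl
  have hi2 := wt_int (n := n) (by omega) (-e) he' lam d hd hdl
  have hwi : Integrable w := hi1.add hi2
  set c : ℝ := rexp (-16 - 256 * π) / (8 * lam) with hc
  have hc0 : 0 < c := by positivity
  have hK : ∀ t x, ‖∫ ξ, (w ξ : ℂ) * eC (2 * π * ⟪x, ξ⟫ + 2 * π * (σ * t) * ‖ξ‖)‖ ≤ k t := by
    intro t x
    have habs : |σ * t| = |t| := by rcases hσ with h | h <;> simp [h]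
    have b1 := hC e he lam d hd hdl (σ * t) x
    have b2 := hC (-e) he' lam d hd hdl (σ * t) x
    rw [habs] at b1 b2
    have hm : Continuous fun ξ : E n => eC (2 * π * ⟪x, ξ⟫ + 2 * π * (σ * t) * ‖ξ‖) :=
      eC_cont.comp (by fun_prop)
    have hIntg : ∀ v : E n → ℝ, Integrable v → Integrable (fun ξ => (v ξ : ℂ) *
        eC (2 * π * ⟪x, ξ⟫ + 2 * π * (σ * t) * ‖ξ‖)) := fun v hv =>
      (hv.ofReal (𝕜 := ℂ)).mul_bdd (c := 1) hm.aestronglyMeasurable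
        (ae_of_all _ fun ξ => (eC_norm _).le)
    have hsplit : ∫ ξ, (w ξ : ℂ) * eC (2 * π * ⟪x, ξ⟫ + 2 * π * (σ * t) * ‖ξ‖) =
        (∫ ξ, (wt e lam d ξ : ℂ) * eC (2 * π * ⟪x, ξ⟫ + 2 * π * (σ * t) * ‖ξ‖)) +
        ∫ ξ, (wt (-e) lam d ξ : ℂ) * eC (2 * π * ⟪x, ξ⟫ + 2 * π * (σ * t) * ‖ξ‖) := by
      rw [← integral_add (hIntg _ hi1) (hIntg _ hi2)]
      congr 1; ext ξ; rw [hw]; push_cast; ring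
    rw [hsplit]
    refine (norm_add_le _ _).trans ((add_le_add b1 b2).trans ?_)
    have : 0 ≤ (lam * d) ^ p * (1 + d * |t|) ^ (-p) := by positivity
    rw [hk]; simp only
    nlinarith
  have hcontx : ∀ t, Continuous fun x => ∫ ξ : E n, eC (2 * π * ⟪x, ξ⟫) *
      (eC (σ * 2 * π * t * ‖ξ‖) * g ξ) := by
    intro t
    refine continuous_of_dominated (bound := fun ξ => ‖g ξ‖) ?_ ?_ hgi.norm ?_
    · intro x
      refine AEStronglyMeasurable.mul ?_ (AEStronglyMeasurable.mul ?_ hgi.aestronglyMeasurable)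
      · exact (eC_cont.comp (by fun_prop)).aestronglyMeasurable
      · exact (eC_cont.comp (by fun_prop)).aestronglyMeasurable
    · intro x; refine ae_of_all _ fun ξ => ?_
      simp [eC_norm]
    · refine ae_of_all _ fun ξ => ?_
      exact (eC_cont.comp (by fun_prop)).mul continuous_const
  have hcontt : ∀ x, Continuous fun t : ℝ => ∫ ξ : E n, eC (2 * π * ⟪x, ξ⟫) *
      (eC (σ * 2 * π * t * ‖ξ‖) * g ξ) := by
    intro x
    refine continuous_of_dominated (bound := fun ξ => ‖g ξ‖) ?_ ?_ hgi.norm ?_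
    · intro t
      refine AEStronglyMeasurable.mul ?_ (AEStronglyMeasurable.mul ?_ hgi.aestronglyMeasurable)
      · exact (eC_cont.comp (by fun_prop)).aestronglyMeasurable
      · exact (eC_cont.comp (by fun_prop)).aestronglyMeasurable
    · intro t; refine ae_of_all _ fun ξ => ?_
      simp [eC_norm]
    · refine ae_of_all _ fun ξ => ?_
      exact continuous_const.mul ((eC_cont.comp (by fun_prop)).mul continuous_const)
  have hfin := lsc_bound (fun t x => ∫ ξ : E n, eC (2 * π * ⟪x, ξ⟫) *
      (eC (σ * 2 * π * t * ‖ξ‖) * g ξ)) (fun x => (hcontt x).measurable) hcontx (∫ ξ, ‖g ξ‖)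
    (by
      intro t x
      refine (norm_integral_le_integral_norm _).trans (le_of_eq ?_)
      simp [eC_norm])
    (ENNReal.ofReal (c⁻¹ * (∫ t, k t) * ∫ ξ, ‖g ξ‖ ^ 2))
    (fun X hX => ttstar_E w (fun ξ => add_nonneg (wt_nonneg _ _ _ _) (wt_nonneg _ _ _ _)) hwi g
      hgi hg2 c hc0 (fun ξ hξ => by
        obtain ⟨h1, h2, h3⟩ := hsupp ξ hξ
        exact wt_lower e he lam d hd hdl ξ h1 h2 h3) σ k (fun t => by positivity) hki hkM hK X hX)
  refine hfin.trans (le_of_eq ?_)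
  have hca : c⁻¹ * (∫ t, k t) = (√D * a) ^ 2 := by
    rw [mul_pow, Real.sq_sqrt hD0.le, hkI, hc, ha, mul_pow, ← Real.rpow_natCast, ← Real.rpow_natCast,
      ← Real.rpow_mul hl.le, ← Real.rpow_mul hd.le, Real.mul_rpow hl.le hd.le]
    have e1 : ((n:ℝ) + 1) / 4 * ((2:ℕ):ℝ) = p + 1 := by rw [hp]; push_cast; ring
    have e2 : ((n:ℝ) - 3) / 4 * ((2:ℕ):ℝ) = p - 1 := by rw [hp]; push_cast; ring
    rw [e1, e2, Real.rpow_add hl, Real.rpow_sub hd, Real.rpow_one, Real.rpow_one, hD]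
    have e3 : rexp (16 + 256 * π) = (rexp (-16 - 256 * π))⁻¹ := by
      rw [← Real.exp_neg]; congr 1; ring
    rw [e3]
    field_simp
    ring
  have ha0 : 0 ≤ a := by positivity
  rw [hca, ENNReal.ofReal_mul (by positivity), ENNReal.mul_rpow_of_nonneg _ _ (by norm_num),
    ENNReal.ofReal_rpow_of_nonneg (by positivity) (by norm_num), ← Real.sqrt_eq_rpow,
    Real.sqrt_sq (by positivity), ENNReal.ofReal_mul (by positivity),
    ENNReal.ofReal_mul (by norm_num : (0:ℝ) ≤ 2)]
  simp only [ENNReal.ofReal_ofNat]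
  ring

lemma spFT_nonint (f : E n → ℂ) (hf : ¬ Integrable f) : spFT f = 0 := by
  ext ξ
  unfold spFT
  refine integral_undef fun h => hf ?_
  have hm : Continuous fun x : E n => eC (2 * π * ⟪x, ξ⟫) := eC_cont.comp (by fun_prop)
  refine (h.bdd_mul (c := 1) hm.aestronglyMeasurable
    (ae_of_all _ fun x => (eC_norm _).le)).congr (ae_of_all _ fun x => ?_)
  simp only
  rw [← mul_assoc, ← eC_add]
  simp [eC]

lemma spFT_cont (f : E n → ℂ) : Continuous (spFT f) := by
  by_cases hf : Integrable f
  · unfold spFT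
    refine continuous_of_dominated (bound := fun ξ => ‖f ξ‖) ?_ ?_ hf.norm ?_
    · intro x
      refine AEStronglyMeasurable.mul ?_ hf.aestronglyMeasurable
      exact (eC_cont.comp (by fun_prop)).aestronglyMeasurable
    · intro x; refine ae_of_all _ fun ξ => ?_
      simp [eC_norm]
    · refine ae_of_all _ fun ξ => ?_
      exact (eC_cont.comp (by fun_prop)).mul continuous_const
  · rw [spFT_nonint f hf]; exact continuous_zero

lemma spFT_eq (f : E n → ℂ) : spFT f = FourierTransform.fourier f := by
  ext ξ
  rw [Real.fourier_eq']
  unfold spFT eC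
  congr 1; ext x
  rw [smul_eq_mul]
  congr 4; ring

lemma inv_eq (g : E n → ℂ) (x : E n) :
    ∫ ξ : E n, eC (2 * π * ⟪x, ξ⟫) * g ξ = FourierTransformInv.fourierInv g x := by
  rw [Real.fourierInv_eq']
  unfold eC
  congr 1; ext ξ
  rw [smul_eq_mul, real_inner_comm]

lemma spFT_inv (g : E n → ℂ) (hg : Continuous g) (hgi : Integrable g)
    (hf : Integrable (fun x : E n => ∫ ξ : E n, eC (2 * π * ⟪x, ξ⟫) * g ξ)) :
    spFT (fun x : E n => ∫ ξ : E n, eC (2 * π * ⟪x, ξ⟫) * g ξ) = g := by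
  have h1 : (fun x : E n => ∫ ξ : E n, eC (2 * π * ⟪x, ξ⟫) * g ξ) =
      FourierTransformInv.fourierInv g := by ext x; exact inv_eq g x
  rw [h1] at hf ⊢
  rw [spFT_eq]
  refine hg.fourier_fourierInv_eq hgi ?_
  have := hf.comp_neg
  refine this.congr (ae_of_all _ fun x => ?_)
  simp only
  rw [Real.fourierInv_eq_fourier_neg, neg_neg]

lemma planch (f g : E n → ℂ) (hgi : Integrable g) (hfi : Integrable f)
    (hf : ∀ x, f x = ∫ ξ : E n, eC (2 * π * ⟪x, ξ⟫) * g ξ) (hg : spFT f = g) :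
    ENNReal.ofReal (∫ ξ, ‖g ξ‖ ^ 2) ^ ((1:ℝ)/2) = eLpNorm f 2 volume := by
  have hF : Integrable (fun p : E n × E n => starRingEnd ℂ (g p.1) *
      (eC (-(2 * π * ⟪p.2, p.1⟫)) * f p.2)) (volume.prod volume) := by
    refine (hgi.norm.mul_prod hfi.norm).mono' ?_ (ae_of_all _ fun p => ?_)
    · refine AEStronglyMeasurable.mul
        (Complex.continuous_conj.comp_aestronglyMeasurable hgi.aestronglyMeasurable.comp_fst)
        (AEStronglyMeasurable.mul ?_ hfi.aestronglyMeasurable.comp_snd)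
      exact (eC_cont.comp (by fun_prop)).aestronglyMeasurable
    · simp [eC_norm]
  have h1 : ((∫ ξ, ‖g ξ‖ ^ 2 : ℝ) : ℂ) = ((∫ x, ‖f x‖ ^ 2 : ℝ) : ℂ) := by
    calc ((∫ ξ, ‖g ξ‖ ^ 2 : ℝ) : ℂ) = ∫ ξ, starRingEnd ℂ (g ξ) * spFT f ξ := by
          rw [← integral_complex_ofReal, hg]
          congr 1; ext t
          rw [mul_comm, Complex.mul_conj, Complex.normSq_eq_norm_sq]
      _ = ∫ ξ, ∫ x, starRingEnd ℂ (g ξ) * (eC (-(2 * π * ⟪x, ξ⟫)) * f x) := by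
          congr 1; ext ξ
          rw [integral_const_mul]; rfl
      _ = ∫ x, ∫ ξ, starRingEnd ℂ (g ξ) * (eC (-(2 * π * ⟪x, ξ⟫)) * f x) :=
          integral_integral_swap hF
      _ = ∫ x, f x * starRingEnd ℂ (f x) := by
          congr 1; ext x
          have hcj : starRingEnd ℂ (f x) =
              ∫ ξ : E n, starRingEnd ℂ (eC (2 * π * ⟪x, ξ⟫) * g ξ) := by
            rw [integral_conj, ← hf x]
          rw [hcj, ← integral_const_mul]
          congr 1; ext ξ
          rw [map_mul, eC_conj]; ring
      _ = _ := by
          rw [← integral_complex_ofReal]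
          congr 1; ext t
          rw [Complex.mul_conj, Complex.normSq_eq_norm_sq]
  have h2 : ∫ ξ, ‖g ξ‖ ^ 2 = ∫ x, ‖f x‖ ^ 2 := by exact_mod_cast h1
  have hfb : ∀ x, ‖f x‖ ≤ ∫ ξ, ‖g ξ‖ := by
    intro x
    rw [hf x]
    refine (norm_integral_le_integral_norm _).trans (le_of_eq ?_)
    simp [eC_norm]
  have hf2 : Integrable (fun x => ‖f x‖ ^ 2) := by
    have := hfi.norm.mul_bdd (c := ∫ ξ, ‖g ξ‖) hfi.norm.aestronglyMeasurable
      (ae_of_all _ fun x => by simpa using hfb x)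
    refine this.congr (ae_of_all _ fun x => ?_)
    simp only; ring
  rw [h2, ofReal_integral_eq_lintegral_ofReal hf2 (ae_of_all _ fun x => by positivity),
    eLpNorm_eq_lintegral_rpow_enorm_toReal (by norm_num) (by norm_num)]
  simp only [ENNReal.toReal_ofNat]
  congr 2; ext x
  rw [← ofReal_norm, ENNReal.ofReal_pow (norm_nonneg _)]
  norm_cast

lemma sq_int (g : E n → ℂ) (hgc : Continuous g) (hcs : HasCompactSupport g) :
    Integrable (fun ξ => ‖g ξ‖ ^ 2) := by
  have h1 : Integrable (fun ξ => ‖g ξ‖ * ‖g ξ‖) :=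
    (hgc.norm.mul hgc.norm).integrable_of_hasCompactSupport hcs.norm.mul_left
  refine h1.congr (ae_of_all _ fun ξ => ?_)
  simp only; ring

/-- local Strichartz estimate on radially directed blocks: for `5 < n`,
uniformly in `λ`, `d ≤ λ` and `ω`,
`‖e^{±2πit|D_x|}B^ω_{λ,(λd)^{1/2}}u‖_{L²_t(L^∞_x)} ≤ C λ^{(n+1)/4} d^{(n-3)/4}
‖B^ω_{λ,(λd)^{1/2}}u‖_{L²}`. -/
theorem local_strichartz (n : ℕ) (hn : 5 < n) (A : AngularSystem n) :
    ∃ C : ℝ≥0, ∀ (k j : ℤ), dy j ≤ dy k → ∀ (ω : ℕ) (σ : ℝ), σ = 1 ∨ σ = -1 →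
      ∀ u : E n → ℂ,
        LqLr 2 ⊤ (halfWave σ (BOmSp A (dy k) (Real.sqrt (dy k * dy j)) ω u))
          ≤ C * ENNReal.ofReal (dy k ^ (((n : ℝ) + 1) / 4) * dy j ^ (((n : ℝ) - 3) / 4)) *
            eLpNorm (BOmSp A (dy k) (Real.sqrt (dy k * dy j)) ω u) 2 volume := by
  obtain ⟨C, hC0, hC⟩ := main_g (n := n) hn
  refine ⟨C.toNNReal, ?_⟩
  intro k j hjk ω σ hσ u
  have hd : 0 < dy j := by unfold dy; positivity
  have hl : 0 < dy k := by unfold dy; positivity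
  set lam := dy k with hlam
  set d := dy j with hdd
  set del := √(lam * d) with hdel
  have hdel0 : 0 < del := Real.sqrt_pos.2 (by positivity)
  have hdell : del ≤ 3 * lam := by
    rw [hdel, Real.sqrt_le_left (by positivity)]
    nlinarith
  set f := BOmSp A lam del ω u with hf
  by_cases hfi : Integrable f
  · set g : E n → ℂ := fun ξ => ((A.b lam del ω ξ : ℝ) : ℂ) * spFT u ξ with hg
    have hgc : Continuous g :=
      (Complex.continuous_ofReal.comp (A.smooth lam del ω).continuous).mul (spFT_cont u)
    have hsupp : ∀ ξ, g ξ ≠ 0 → lam / 4 ≤ ‖ξ‖ ∧ ‖ξ‖ ≤ 8 * lam ∧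
        ‖ξ - ⟪ξ, A.dir lam del ω⟫ • A.dir lam del ω‖ ≤ 8 * √(lam * d) := by
      intro ξ hξ
      refine A.supp_sub lam del ω ξ hdel0 hdell fun h0 => hξ ?_
      rw [hg]; simp [h0]
    have hcs : HasCompactSupport g := by
      refine HasCompactSupport.of_support_subset_isCompact
        (isCompact_closedBall (0 : E n) (8 * lam)) fun ξ hξ => ?_
      simpa using (hsupp ξ hξ).2.1
    have hgi : Integrable g := hgc.integrable_of_hasCompactSupport hcs
    have hg2 : Integrable (fun ξ => ‖g ξ‖ ^ 2) := sq_int g hgc hcs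
    have hfe : f = fun x => ∫ ξ : E n, eC (2 * π * ⟪x, ξ⟫) * g ξ := rfl
    have hFg : spFT f = g := by
      rw [hfe] at hfi ⊢
      exact spFT_inv g hgc hgi hfi
    have hmain := hC (A.dir lam del ω) (A.dir_norm lam del ω hdel0 hdell) lam d hd hjk σ hσ g hgi hg2
      hsupp
    rw [planch f g hgi hfi (fun x => congrFun hfe x) hFg] at hmain
    have hhw : halfWave σ f = fun t x => ∫ ξ : E n, eC (2 * π * ⟪x, ξ⟫) *
        (eC (σ * 2 * π * t * ‖ξ‖) * g ξ) := by
      ext t x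
      unfold halfWave spMult
      rw [hFg]
    rw [hhw]
    exact hmain
  · have hz : halfWave σ f = fun _ _ => 0 := by
      ext t x
      unfold halfWave spMult
      rw [spFT_nonint f hfi]
      simp
    have hz' : LqLr 2 ⊤ (halfWave σ f) = 0 := by
      rw [hz]
      have h0 : eLpNorm (fun _ : E n => (0:ℂ)) ⊤ volume = 0 := eLpNorm_zero
      unfold LqLr
      simp only [h0, ENNReal.toReal_zero]
      exact eLpNorm_zero
    rw [hz']
    exact zero_le

end NLW
end
end

section
/- There exist constants c > 0 and C such that the following angular interaction bound holds (the content of the wide angle decomposition): let λ, μ, d be dyadic with d ≤ cμ and μ ≤ cλ, and suppose (τ',ξ') lies in the support of the symbol of S^±_{μ,•≤d} (so |ξ'| ∼ μ and |±τ' − (±)|ξ'|| ≲ d with ±τ' > 0), (τ,ξ) lies in the support of the symbol of S^+_{λ,•≤d} (so |ξ| ∼ λ, ||τ|−|ξ|| ≲ d, τ > 0), and (τ'+τ, ξ'+ξ) lies in the support of the symbol of S^+_{λ,d} (so ||τ'+τ| − |ξ'+ξ|| ∼ d). Then the angle Θ between ±ξ' and ξ satisfies μΘ² ≤ C| ±|ξ'|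 + |ξ| − |ξ'+ξ| | and consequently Θ ≤ C(d/μ)^{1/2}. -/
/- Common setup: space-time ℝ^{1+n}, Fourier multipliers, dyadic norms, function
   spaces of Tataru type, following Sterbenz, "Global Regularity for General
   Non-Linear Wave Equations I". -/

open MeasureTheory Filter Real
open scoped ENNReal NNReal Topology RealInnerProductSpace

noncomputable section

namespace NLW

variable {n : ℕ}

lemma dy_pos (j : ℤ) : 0 < dy j := by unfold dy; positivity

lemma phi_ne_zero (B : BumpFn) {x L : ℝ} (hL : 0 < L) (h : B.φ (x / (2 * L)) ≠ 0) :
    |x| < 4 * L := by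
  by_contra hc
  push Not at hc
  apply h
  apply B.supp_sub
  rw [abs_div, abs_of_pos (by positivity : (0:ℝ) < 2 * L), le_div_iff₀ (by positivity)]
  linarith

lemma phi_diff (B : BumpFn) {x L : ℝ} (hL : 0 < L) (hx : 0 ≤ x)
    (h : B.φ (x / (2 * L)) - B.φ (x / (L / 2)) ≠ 0) : L / 2 < x ∧ x < 4 * L := by
  constructor
  · by_contra hc
    push Not at hc
    apply h
    rw [B.one_on, B.one_on, sub_self]
    · rw [abs_of_nonneg (by positivity), div_le_one (by positivity)]; exact hc
    · rw [abs_of_nonneg (by positivity), div_le_one (by positivity)]; linarith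
  · by_contra hc
    push Not at hc
    apply h
    rw [B.supp_sub, B.supp_sub, sub_self]
    · rw [abs_of_nonneg (by positivity), le_div_iff₀ (by positivity)]; linarith
    · rw [abs_of_nonneg (by positivity), le_div_iff₀ (by positivity)]; linarith

lemma sSym_supp (B : BumpFn) {L τ : ℝ} {ξ : E n} (hL : 0 < L) (h : sSym B L τ ξ ≠ 0) :
    L / 2 < |τ| + ‖ξ‖ ∧ ‖ξ‖ < 4 * L := by
  unfold sSym at h
  rw [Complex.ofReal_ne_zero] at h
  obtain ⟨h1, h2⟩ := phi_diff B hL (Real.sqrt_nonneg _) h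
  constructor
  · refine h1.trans_le ?_
    apply Real.sqrt_le_iff.2
    refine ⟨by positivity, ?_⟩
    have := mul_nonneg (abs_nonneg τ) (norm_nonneg ξ)
    nlinarith [sq_abs τ]
  · refine lt_of_le_of_lt ?_ h2
    apply Real.le_sqrt_of_sq_le
    nlinarith [sq_nonneg τ]

lemma cLE_supp (B : BumpFn) {d τ : ℝ} {ξ : E n} (hd : 0 < d) (h : cLE B d τ ξ ≠ 0) :
    |(|τ| - ‖ξ‖)| < 4 * d := by
  unfold cLE at h
  rw [Complex.ofReal_ne_zero] at h
  simpa using phi_ne_zero B hd h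

lemma cSym_supp (B : BumpFn) {d τ : ℝ} {ξ : E n} (hd : 0 < d) (h : cSym B d τ ξ ≠ 0) :
    |(|τ| - ‖ξ‖)| < 4 * d := by
  unfold cSym at h
  rw [Complex.ofReal_ne_zero] at h
  exact (phi_diff B hd (abs_nonneg _) h).2

/-- Core geometric bound. -/
lemma angle_core (σ : ℝ) (hσ : σ = 1 ∨ σ = -1) (x y : E n) (hxy : ‖x‖ ≤ ‖y‖) (hy : 0 < ‖y‖) :
    ‖x‖ * InnerProductGeometry.angle (σ • x) y ^ 2 ≤ 16 * |σ * ‖x‖ + ‖y‖ - ‖x + y‖| := by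
  set Θ := InnerProductGeometry.angle (σ • x) y with hΘ
  have hs2 : σ ^ 2 = 1 := by rcases hσ with h | h <;> rw [h] <;> norm_num
  have hsa : |σ| = 1 := by rcases hσ with h | h <;> rw [h] <;> norm_num
  have hcos : Real.cos Θ * (‖x‖ * ‖y‖) = σ * ⟪x, y⟫ := by
    have := InnerProductGeometry.cos_angle_mul_norm_mul_norm (σ • x) y
    rw [norm_smul, Real.norm_eq_abs, hsa, one_mul, real_inner_smul_left] at this
    exact this
  have hsq : ‖x + y‖ ^ 2 = ‖x‖ ^ 2 + 2 * ⟪x, y⟫ + ‖y‖ ^ 2 := norm_add_sq_real x y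
  have h0 : 0 ≤ Θ := InnerProductGeometry.angle_nonneg _ _
  have hpi : Θ ≤ π := InnerProductGeometry.angle_le_pi _ _
  have hub := Real.cos_le_one_sub_mul_cos_sq (x := Θ) (by rw [abs_of_nonneg h0]; exact hpi)
  have hcb : Θ ^ 2 ≤ 8 * (1 - Real.cos Θ) := by
    have h1 : (1:ℝ) / 8 ≤ 2 / π ^ 2 := by
      rw [div_le_div_iff₀ (by norm_num) (by positivity)]
      nlinarith [Real.pi_pos, Real.pi_le_four]
    nlinarith [mul_le_mul_of_nonneg_right h1 (sq_nonneg Θ)]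
  have hfac : (σ * ‖x‖ + ‖y‖ - ‖x + y‖) * (σ * ‖x‖ + ‖y‖ + ‖x + y‖)
      = σ * (2 * (‖x‖ * ‖y‖) * (1 - Real.cos Θ)) := by
    linear_combination ‖x‖ ^ 2 * hs2 - hsq + 2 * σ * hcos + 2 * ⟪x, y⟫ * hs2
  have hc1 : 0 ≤ 1 - Real.cos Θ := by linarith [Real.cos_le_one Θ]
  have habs := congrArg abs hfac
  rw [abs_mul, abs_mul, hsa, one_mul, abs_of_nonneg (a := 2 * (‖x‖ * ‖y‖) * (1 - Real.cos Θ))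
    (by positivity)] at habs
  have htri := norm_add_le x y
  have hb : |σ * ‖x‖ + ‖y‖ + ‖x + y‖| ≤ 4 * ‖y‖ := by
    have h1 : |σ * ‖x‖| = ‖x‖ := by rw [abs_mul, hsa, one_mul, abs_of_nonneg (norm_nonneg x)]
    have h2 := abs_le.1 h1.le
    rw [abs_le]
    constructor <;> linarith [norm_nonneg (x + y), h2.1, h2.2]
  have h3 : 2 * (‖x‖ * ‖y‖) * (1 - Real.cos Θ) ≤ |σ * ‖x‖ + ‖y‖ - ‖x + y‖| * (4 * ‖y‖) := by
    rw [← habs]; exact mul_le_mul_of_nonneg_left hb (abs_nonneg _)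
  have h4 : ‖x‖ * (1 - Real.cos Θ) ≤ 2 * |σ * ‖x‖ + ‖y‖ - ‖x + y‖| := by
    refine le_of_mul_le_mul_right ?_ hy
    linarith
  have h5 := mul_le_mul_of_nonneg_left hcb (norm_nonneg x)
  linarith

/-- the angular interaction bound behind the wide angle decomposition:
there are `c, C > 0` such that for dyadic `d ≤ cμ`, `μ ≤ cλ`, if `(τ',ξ')` lies in the
support of the symbol of `S^±_{μ,•≤d}`, `(τ,ξ)` in that of `S^+_{λ,•≤d}`, and
`(τ'+τ, ξ'+ξ)` in that of `S^+_{λ,d}`, then the angle `Θ` between `±ξ'` and `ξ`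
satisfies `μΘ² ≤ C|±|ξ'| + |ξ| - |ξ'+ξ||` and consequently `Θ ≤ C(d/μ)^{1/2}`. -/
theorem wide_angle_bound (n : ℕ) (B : BumpFn) :
    ∃ c C : ℝ, 0 < c ∧ 0 < C ∧
      ∀ (k m j : ℤ), dy j ≤ c * dy m → dy m ≤ c * dy k →
      ∀ σ : ℝ, σ = 1 ∨ σ = -1 →
      ∀ (τ' : ℝ) (ξ' : E n) (τ : ℝ) (ξ : E n),
        sSym B (dy m) τ' ξ' * cLE B (dy j) τ' ξ' ≠ 0 → 0 < σ * τ' →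
        sSym B (dy k) τ ξ * cLE B (dy j) τ ξ ≠ 0 → 0 < τ →
        sSym B (dy k) (τ' + τ) (ξ' + ξ) * cSym B (dy j) (τ' + τ) (ξ' + ξ) ≠ 0 →
        0 < τ' + τ →
        dy m * (InnerProductGeometry.angle (σ • ξ') ξ) ^ 2
            ≤ C * |σ * ‖ξ'‖ + ‖ξ‖ - ‖ξ' + ξ‖| ∧
          InnerProductGeometry.angle (σ • ξ') ξ ≤ C * (dy j / dy m) ^ ((1 : ℝ) / 2) := by
  refine ⟨1 / 100, 100, by norm_num, by norm_num, ?_⟩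
  intro k m j hjm hmk σ hσ τ' ξ' τ ξ h1 hτ' h2 hτ h3 hττ
  have hj := dy_pos j
  have hm := dy_pos m
  have hk := dy_pos k
  have hA := sSym_supp B hm (left_ne_zero_of_mul h1)
  have hA2 := cLE_supp B hj (right_ne_zero_of_mul h1)
  have hB := sSym_supp B hk (left_ne_zero_of_mul h2)
  have hB2 := cLE_supp B hj (right_ne_zero_of_mul h2)
  have hC2 := cSym_supp B hj (right_ne_zero_of_mul h3)
  have hA2' := abs_lt.1 hA2
  have hB2' := abs_lt.1 hB2
  have hC2' := abs_lt.1 hC2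
  rw [abs_of_pos hτ] at hB hB2'
  rw [abs_of_pos hττ] at hC2'
  have ha : dy m / 5 ≤ ‖ξ'‖ := by linarith [hA.1, hA2'.2]
  have hb : dy k / 5 ≤ ‖ξ‖ := by linarith [hB.1, hB2'.2]
  have hcore := angle_core σ hσ ξ' ξ (by linarith [hA.2]) (by linarith)
  have hdist : |σ * ‖ξ'‖ + ‖ξ‖ - ‖ξ' + ξ‖| ≤ 12 * dy j := by
    rcases hσ with h | h
    · rw [h, one_mul] at hτ'
      rw [abs_of_pos hτ'] at hA2'
      rw [h, abs_le]
      constructor <;> linarith [hA2'.1, hA2'.2, hB2'.1, hB2'.2, hC2'.1, hC2'.2]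
    · rw [h] at hτ'
      rw [abs_of_neg (by linarith)] at hA2'
      rw [h, abs_le]
      constructor <;> linarith [hA2'.1, hA2'.2, hB2'.1, hB2'.2, hC2'.1, hC2'.2]
  set Θ := InnerProductGeometry.angle (σ • ξ') ξ with hΘ
  have h0 : 0 ≤ Θ := InnerProductGeometry.angle_nonneg _ _
  have hmul := mul_le_mul_of_nonneg_right ha (sq_nonneg Θ)
  have hD := abs_nonneg (σ * ‖ξ'‖ + ‖ξ‖ - ‖ξ' + ξ‖)
  refine ⟨by linarith, ?_⟩
  rw [← Real.sqrt_eq_rpow]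
  have hq : Θ ^ 2 ≤ 100 ^ 2 * (dy j / dy m) := by
    rw [← mul_div_assoc, le_div_iff₀ hm]
    linarith
  have := Real.le_sqrt_of_sq_le hq
  rwa [Real.sqrt_mul (by norm_num), Real.sqrt_sq (by norm_num)] at this

end NLW
end
end
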